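/- arXiv:2503.19603 — 2 statements merged into one kernel-verified Lean document; each statement's English description precedes it below -/
import Mathlib

section
/- Let k and m be fixed integers with 2 ≤ k ≤ m. For every ε > 0 there exists Q > 0 such that for every odd prime power q ≥ Q, the number of k-Diophantine m-tuples over F_q differs from q^m / (m! · 2^{binom(m,k)}) by at most ε·q^m. -/
/-- The number of `k`-Diophantine `m`-tuples over `F_q`: the number of `m`-element subsets
`A ⊆ F_q` such that `a_1 a_2 ⋯ a_k + 1` is a square in `F_q` whenever `a_1,…,a_k` are
distinct elements of `A`. -/
noncomputable def kDiophCount (F : Type*) [Field F] [Fintype F] (k m : ℕ) : ℕ :=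
  Set.ncard {A : Finset F | A.card = m ∧
    ∀ a : Fin k → F, Function.Injective a → (∀ i, a i ∈ A) →
      IsSquare ((∏ i, a i) + 1)}

open Polynomial

lemma hd_pow {F : Type*} [Field F] (f : F[X]) (n : ℕ) (hf : f.natDegree ≤ n) (h : ℕ) :
    ∀ i : ℕ, ∃ K : F[X], f ^ i * hasseDeriv i (f ^ h) = f ^ h * K ∧ K.natDegree ≤ n * i := by
  induction h with
  | zero =>
    intro i
    rcases Nat.eq_zero_or_pos i with rfl | hi
    · exact ⟨1, by simp, by simp⟩
    · exact ⟨0, by simp [← C_1, hasseDeriv_C i _ hi, -map_one], by simp⟩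
  | succ h ih =>
    choose K hK hKd using ih
    intro i
    refine ⟨∑ ab ∈ Finset.HasAntidiagonal.antidiagonal i,
      (if ab.1 = 0 then K ab.2 else f ^ (ab.1 - 1) * hasseDeriv ab.1 f * K ab.2), ?_, ?_⟩
    · rw [pow_succ' f h, hasseDeriv_mul, Finset.mul_sum, Finset.mul_sum]
      refine Finset.sum_congr rfl fun ab hab => ?_
      rw [Finset.HasAntidiagonal.mem_antidiagonal] at hab
      subst hab
      rw [pow_add]
      split_ifs with h0
      · rw [h0]
        simp only [hasseDeriv_zero, pow_zero, one_mul, LinearMap.id_coe, id_eq]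
        linear_combination f * hK ab.2
      · obtain ⟨a, ha⟩ := Nat.exists_eq_succ_of_ne_zero h0
        rw [ha]
        simp only [Nat.succ_eq_add_one, Nat.add_sub_cancel]
        linear_combination f ^ (a+1) * hasseDeriv (a+1) f * hK ab.2
    · refine natDegree_sum_le_of_forall_le _ _ fun ab hab => ?_
      rw [Finset.HasAntidiagonal.mem_antidiagonal] at hab
      subst hab
      split_ifs with h0
      · rw [h0, zero_add]; exact hKd _
      · obtain ⟨a, ha⟩ := Nat.exists_eq_succ_of_ne_zero h0
        rw [ha]
        simp only [Nat.succ_eq_add_one, Nat.add_sub_cancel]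
        refine natDegree_mul_le.trans ?_
        have h1 : (f ^ a * hasseDeriv (a+1) f).natDegree ≤ n * a + n := by
          refine natDegree_mul_le.trans (add_le_add ?_ ?_)
          · refine natDegree_pow_le.trans ?_
            rw [mul_comm]; exact Nat.mul_le_mul_right _ hf
          · exact (natDegree_hasseDeriv_le _ _).trans ((Nat.sub_le _ _).trans hf)
        have := hKd ab.2
        nlinarith

lemma pow_q_sub {F : Type*} [Field F] [Fintype F] (f : F[X]) (h0 : f.coeff 0 = 1) :
    (X : F[X]) ^ (Fintype.card F) ∣ f ^ (Fintype.card F) - 1 := by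
  rw [← FiniteField.expand_card f, X_pow_dvd_iff]
  intro d hd
  rw [coeff_sub, coeff_expand Fintype.card_pos]
  rcases Nat.eq_zero_or_pos d with rfl | hp
  · simp [h0]
  · rw [if_neg (Nat.not_dvd_of_pos_of_lt hp hd), coeff_one, if_neg (by omega)]; simp

lemma nonvan {F : Type*} [Field F] [Fintype F] (f : F[X]) (h0 : f.coeff 0 = 1)
    (hsq : ∀ r s : F[X], r ^ 2 * f = s ^ 2 → r = 0 ∧ s = 0) (h n B : ℕ)
    (hf : f.natDegree ≤ n)
    (hq : Fintype.card F = 2 * h + 1) (hB : 2 * B + n < Fintype.card F) (J : ℕ) :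
    ∀ r s : ℕ → F[X], (∀ j, (r j).natDegree ≤ B) → (∀ j, (s j).natDegree ≤ B) →
      ∑ j ∈ Finset.range J, (r j + s j * f ^ h) * X ^ (Fintype.card F * j) = 0 →
      ∀ j < J, r j = 0 ∧ s j = 0 := by
  induction J with
  | zero => intro r s _ _ _ j hj; omega
  | succ J ih =>
    intro r s hr hs hsum
    rw [Finset.sum_range_succ'] at hsum
    have e : ∑ j ∈ Finset.range J, (r (j+1) + s (j+1) * f ^ h) * X ^ (Fintype.card F * (j+1))
      = X ^ (Fintype.card F) * ∑ j ∈ Finset.range J, (r (j+1) + s (j+1) * f ^ h) * X ^ (Fintype.card F * j) := by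
      rw [Finset.mul_sum]
      refine Finset.sum_congr rfl fun j _ => ?_
      ring
    rw [e] at hsum
    simp only [mul_zero, pow_zero, mul_one] at hsum
    have hz : r 0 = 0 ∧ s 0 = 0 := by
      apply hsq
      have d1 : (X : F[X]) ^ (Fintype.card F) ∣ r 0 + s 0 * f ^ h :=
        ⟨-∑ j ∈ Finset.range J, (r (j+1) + s (j+1) * f ^ h) * X ^ (Fintype.card F * j),
          by linear_combination hsum⟩
      have d2 : (X : F[X]) ^ (Fintype.card F) ∣ r 0 ^ 2 * f - s 0 ^ 2 := by
        have := (d1.mul_left ((r 0 - s 0 * f ^ h) * f)).add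
          ((pow_q_sub f h0).mul_left (s 0 ^ 2))
        convert this using 1
        have : f ^ Fintype.card F = f ^ h * f ^ h * f := by rw [hq]; ring
        rw [this]; ring
      have := eq_zero_of_dvd_of_natDegree_lt d2 ?_
      · exact sub_eq_zero.mp this
      · rw [natDegree_X_pow]
        refine lt_of_le_of_lt ?_ hB
        refine (natDegree_sub_le _ _).trans (max_le ?_ ?_)
        · refine natDegree_mul_le.trans (add_le_add ?_ hf)
          exact natDegree_pow_le.trans (Nat.mul_le_mul_left _ (hr 0))
        · exact (natDegree_pow_le.trans (Nat.mul_le_mul_left _ (hs 0))).trans (by omega)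
    rw [hz.1, hz.2] at hsum
    simp only [zero_mul, add_zero, mul_eq_zero] at hsum
    have hsum' := hsum.resolve_left (pow_ne_zero _ X_ne_zero)
    have := ih (fun j => r (j+1)) (fun j => s (j+1)) (fun j => hr _) (fun j => hs _) hsum'
    intro j hj
    rcases j with _ | j
    · exact hz
    · exact this j (by omega)

lemma exists_emb (F : Type*) [Field F] (B : ℕ) : ∃ ι : (Fin B → F) →ₗ[F] F[X],
    Function.Injective ι ∧ ∀ v, (ι v).natDegree ≤ B := by
  refine ⟨(degreeLT F B).subtype ∘ₗ (degreeLTEquiv F B).symm.toLinearMap, ?_, ?_⟩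
  · exact Subtype.val_injective.comp (degreeLTEquiv F B).symm.injective
  · intro v
    have := ((degreeLTEquiv F B).symm v).2
    rw [mem_degreeLT] at this
    exact natDegree_le_of_degree_le this.le

set_option maxHeartbeats 800000 in
lemma stepanov {F : Type*} [Field F] [Fintype F] [DecidableEq F] (f : F[X]) (h0 : f.coeff 0 = 1)
    (hsq : ∀ r s : F[X], r ^ 2 * f = s ^ 2 → r = 0 ∧ s = 0) (h n B M : ℕ)
    (hf : f.natDegree ≤ n)
    (hq : Fintype.card F = 2 * h + 1) (hB : 2 * B + n < Fintype.card F)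
    (hM : 2 * M ≤ Fintype.card F) (hBM : M * (M + 1 + 2 * n * M + 1) < B)
    (a : F) (ha : a ≠ 0) :
    (Finset.univ.filter fun z : F => (f.eval z) ^ h = a).card * (2 * M)
      ≤ B + n * h + Fintype.card F * M := by
  rcases Nat.eq_zero_or_pos h with rfl | hh
  · omega
  obtain ⟨ι, hι, hιd⟩ := exists_emb F B
  choose K hK hKd using hd_pow f n hf h
  let Q : Fin (2*M) → (Fin (M+1) → (Fin B → F) × (Fin B → F)) →ₗ[F] F[X] := fun i =>
    ∑ j : Fin (M+1),
      (LinearMap.mulLeft F (X ^ (j:ℕ) * f ^ (2*M)) ∘ₗ hasseDeriv (i:ℕ) ∘ₗ ι ∘ₗ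
        LinearMap.fst F _ _ ∘ₗ LinearMap.proj j +
      ∑ ab ∈ Finset.HasAntidiagonal.antidiagonal (i:ℕ),
        LinearMap.mulLeft F (X ^ (j:ℕ) * C a * K ab.2 * f ^ (2*M - ab.2)) ∘ₗ hasseDeriv ab.1 ∘ₗ ι ∘ₗ
        LinearMap.snd F _ _ ∘ₗ LinearMap.proj j)
  have hQ : ∀ i v, Q i v = ∑ j : Fin (M+1), (X ^ (j:ℕ) * f ^ (2*M) * hasseDeriv (i:ℕ) (ι (v j).1) +
      ∑ ab ∈ Finset.HasAntidiagonal.antidiagonal (i:ℕ),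
        (X ^ (j:ℕ) * C a * K ab.2 * f ^ (2*M - ab.2)) * hasseDeriv ab.1 (ι (v j).2)) := by
    intro i v
    simp [Q, LinearMap.sum_apply, mul_assoc]
  clear_value Q
  have hfp : ∀ e, (f ^ e).natDegree ≤ n * e := fun e => by
    refine natDegree_pow_le.trans ?_
    rw [mul_comm]; exact Nat.mul_le_mul_right _ hf
  have hQd : ∀ i v, (Q i v).natDegree < M + 1 + 2 * n * M + B := by
    intro i v
    rw [hQ]
    refine Nat.lt_of_le_of_lt (m := M + 2 * n * M + B) ?_ (by omega)
    refine natDegree_sum_le_of_forall_le _ _ fun j _ => ?_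
    have hj : (j:ℕ) ≤ M := by omega
    refine natDegree_add_le_of_degree_le ?_ ?_
    · refine natDegree_mul_le.trans (add_le_add (natDegree_mul_le.trans (add_le_add ?_ ?_)) ?_)
      · rw [natDegree_X_pow]; exact hj
      · exact (hfp _).trans (by nlinarith)
      · exact (natDegree_hasseDeriv_le _ _).trans ((Nat.sub_le _ _).trans (hιd _))
    · refine natDegree_sum_le_of_forall_le _ _ fun ab hab => ?_
      rw [Finset.HasAntidiagonal.mem_antidiagonal] at hab
      have hb : ab.2 ≤ 2 * M := by omega
      refine natDegree_mul_le.trans (add_le_add ?_ ?_)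
      · have h1 : (X ^ (j:ℕ) * C a).natDegree ≤ M :=
          (natDegree_mul_C_le _ _).trans (by rw [natDegree_X_pow]; exact hj)
        have h2 := hKd ab.2
        have h3 := hfp (2*M - ab.2)
        have h4 : n * ab.2 + n * (2*M - ab.2) = 2 * n * M := by
          rw [← mul_add, Nat.add_sub_cancel' hb]; ring
        refine natDegree_mul_le.trans ?_
        have := natDegree_mul_le (p := X ^ (j:ℕ) * C a) (q := K ab.2)
        omega
      · exact (natDegree_hasseDeriv_le _ _).trans ((Nat.sub_le _ _).trans (hιd _))
  let Λ : (Fin (M+1) → (Fin B → F) × (Fin B → F)) →ₗ[F] (Fin (2*M) → Fin (M + 1 + 2 * n * M + B) → F) :=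
    LinearMap.pi fun i => LinearMap.pi fun d => lcoeff F (d:ℕ) ∘ₗ Q i
  have hker : Λ.ker ≠ ⊥ := by
    apply LinearMap.ker_ne_bot_of_finrank_lt
    simp only [Module.finrank_pi_fintype, Module.finrank_prod, Module.finrank_self, Finset.sum_const,
      Finset.card_univ, Fintype.card_fin, smul_eq_mul, mul_one]
    nlinarith
  obtain ⟨v, hv, hv0⟩ := Submodule.exists_mem_ne_zero_of_ne_bot hker
  have hQ0 : ∀ i, Q i v = 0 := by
    intro i
    ext d
    by_cases hd : d < M + 1 + 2 * n * M + B
    · have := congrFun (congrFun (LinearMap.mem_ker.mp hv) i) ⟨d, hd⟩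
      simpa [Λ] using this
    · rw [coeff_eq_zero_of_natDegree_lt]
      · simp
      · have := hQd i v
        omega
  let r : ℕ → F[X] := fun j => if hj : j < M+1 then ι (v ⟨j, hj⟩).1 else 0
  let s : ℕ → F[X] := fun j => if hj : j < M+1 then ι (v ⟨j, hj⟩).2 else 0
  have hr : ∀ j, (r j).natDegree ≤ B := by
    intro j; dsimp only [r]; split_ifs
    · exact hιd _
    · simp
  have hs : ∀ j, (s j).natDegree ≤ B := by
    intro j; dsimp only [s]; split_ifs
    · exact hιd _
    · simp
  set P : F[X] := ∑ j ∈ Finset.range (M+1), (r j + s j * f ^ h) * X ^ (Fintype.card F * j) with hP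
  have hP0 : P ≠ 0 := by
    intro hP0
    have := nonvan f h0 hsq h n B hf hq hB (M+1) r s hr hs hP0
    apply hv0
    funext j
    have h1 := this j j.2
    simp only [r, s, j.2, dif_pos, Fin.eta] at h1
    exact Prod.ext (hι (by simpa using h1.1)) (hι (by simpa using h1.2))
  have hPd : P.natDegree ≤ B + n * h + Fintype.card F * M := by
    refine natDegree_sum_le_of_forall_le _ _ fun j hj => ?_
    rw [Finset.mem_range] at hj
    refine natDegree_mul_le.trans (add_le_add ?_ ?_)
    · refine natDegree_add_le_of_degree_le ((hr j).trans (by omega)) ?_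
      exact natDegree_mul_le.trans (add_le_add (hs j) (hfp h))
    · rw [natDegree_X_pow]; exact Nat.mul_le_mul_left _ (by omega)
  have hmult : ∀ z : F, (f.eval z) ^ h = a → 2 * M ≤ P.rootMultiplicity z := by
    intro z hz
    have hfz : f.eval z ≠ 0 := by
      intro h1
      rw [h1, zero_pow (by omega)] at hz
      exact ha hz.symm
    rw [le_rootMultiplicity_iff hP0, X_sub_C_pow_dvd_iff, ← taylor_apply]
    set P' : F[X] := ∑ j ∈ Finset.range (M+1), C (z ^ j) * (r j + s j * f ^ h) with hP'
    have hd : X ^ (2*M) ∣ taylor z P - taylor z P' := by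
      rw [hP, hP', map_sum, map_sum, ← Finset.sum_sub_distrib]
      refine Finset.dvd_sum fun j _ => ?_
      rw [taylor_mul, taylor_mul, taylor_C, taylor_X_pow, mul_comm (C _), ← mul_sub]
      refine Dvd.dvd.mul_left ?_ _
      rw [pow_mul (X + C z), C_pow]
      refine dvd_trans ?_ (sub_dvd_pow_sub_pow ((X + C z) ^ Fintype.card F) (C z) j)
      have : (X + C z) ^ Fintype.card F = X ^ Fintype.card F + C z := by
        rw [← FiniteField.expand_card]; simp
      rw [this, add_sub_cancel_right]
      exact pow_dvd_pow _ hM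
    have hd' : X ^ (2*M) ∣ taylor z P' := by
      rw [X_pow_dvd_iff]
      intro i hi
      rw [taylor_coeff]
      have h1 := congrArg (eval z) (hQ0 ⟨i, hi⟩)
      rw [hQ] at h1
      have h2 : (f.eval z) ^ (2*M) * eval z (hasseDeriv i P') = 0 := by
        rw [← eval_zero (x := z), ← h1, hP', map_sum, eval_finsetSum, eval_finsetSum,
          Finset.mul_sum, Finset.sum_range]
        refine Finset.sum_congr rfl fun j _ => ?_
        have e1 : hasseDeriv i (C (z ^ (j:ℕ)) * (r j + s j * f ^ h)) =
            C (z ^ (j:ℕ)) * (hasseDeriv i (r j) + hasseDeriv i (s j * f ^ h)) := by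
          rw [← smul_eq_C_mul, map_smul, map_add, smul_eq_C_mul]
        rw [e1, hasseDeriv_mul]
        simp only [r, s, j.2, dif_pos, Fin.eta]
        simp only [eval_mul, eval_add, eval_C, eval_pow, eval_X, eval_finsetSum, mul_add, Finset.mul_sum]
        congr 1
        · ring
        · refine Finset.sum_congr rfl fun ab hab => ?_
          rw [Finset.HasAntidiagonal.mem_antidiagonal] at hab
          have hb : ab.2 ≤ 2 * M := by omega
          have h3 := congrArg (eval z) (hK ab.2)
          simp only [eval_mul, eval_pow, hz] at h3
          have h4 : eval z f ^ (2*M) = eval z f ^ (2*M - ab.2) * eval z f ^ ab.2 := by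
            rw [← pow_add, Nat.sub_add_cancel hb]
          rw [h4]
          linear_combination (eval z f ^ (2*M - ab.2) * z ^ (j:ℕ) * eval z (hasseDeriv ab.1 (ι (v j).2))) * h3
      exact (mul_eq_zero.mp h2).resolve_left (pow_ne_zero _ hfz)
    have := dvd_add hd hd'
    rwa [sub_add_cancel] at this
  refine le_trans ?_ hPd
  refine le_trans ?_ (card_roots' P)
  calc _ = ∑ z ∈ Finset.univ.filter (fun z : F => (f.eval z) ^ h = a), 2 * M := by simp
    _ ≤ ∑ z ∈ Finset.univ.filter (fun z : F => (f.eval z) ^ h = a), P.roots.count z := by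
        refine Finset.sum_le_sum fun z hz => ?_
        rw [count_roots]; exact hmult z (Finset.mem_filter.mp hz).2
    _ ≤ ∑ z : F, P.roots.count z := Finset.sum_le_sum_of_subset (Finset.subset_univ _)
    _ = _ := Multiset.sum_count_eq_card (fun _ _ => Finset.mem_univ _)

lemma prod_nonsq {F : Type*} [Field F] (S : Finset F) (hS : S.Nonempty) (h0 : (0:F) ∉ S)
    (r s : F[X]) (h : r ^ 2 * (∏ c ∈ S, (1 + C c * X)) = s ^ 2) : r = 0 ∧ s = 0 := by
  classical
  obtain ⟨c, hc⟩ := hS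
  have hc0 : c ≠ 0 := fun h => h0 (h ▸ hc)
  by_cases hr : r = 0
  · subst hr
    refine ⟨rfl, ?_⟩
    simpa using h.symm
  exfalso
  rw [← Finset.mul_prod_erase _ _ hc] at h
  set g : F[X] := ∏ d ∈ S.erase c, (1 + C d * X) with hg
  have hgr : ¬ g.IsRoot (-c⁻¹) := by
    rw [IsRoot.def, hg, eval_prod, Finset.prod_eq_zero_iff]
    rintro ⟨d, hd, hd'⟩
    simp only [eval_add, eval_one, eval_mul, eval_C, eval_X] at hd'
    apply Finset.ne_of_mem_erase hd
    field_simp at hd'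
    linear_combination -hd'
  have hg0 : g ≠ 0 := by
    intro h; apply hgr; rw [h]; simp
  have e : (1 + C c * X : F[X]) = C c * (X - C (-c⁻¹)) := by
    have : C c * C c⁻¹ = (1 : F[X]) := by rw [← C_mul, mul_inv_cancel₀ hc0, C_1]
    rw [C_neg]
    linear_combination -this
  have hX : (X - C (-c⁻¹) : F[X]) ≠ 0 := X_sub_C_ne_zero _
  have hCc : (C c : F[X]) ≠ 0 := C_ne_zero.mpr hc0
  have hs : s ≠ 0 := by
    rintro rfl
    have : r ^ 2 * ((1 + C c * X) * g) ≠ 0 := by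
      rw [e]; exact mul_ne_zero (pow_ne_zero _ hr) (mul_ne_zero (mul_ne_zero hCc hX) hg0)
    exact this (by simpa using h)
  have h2 := congrArg (rootMultiplicity (-c⁻¹)) h
  have hp1 := mul_ne_zero hCc hX
  have hp2 := mul_ne_zero hp1 hg0
  rw [e, pow_two, pow_two, rootMultiplicity_mul (mul_ne_zero (mul_ne_zero hr hr) hp2),
    rootMultiplicity_mul (mul_ne_zero hr hr), rootMultiplicity_mul hp2, rootMultiplicity_mul hp1,
    rootMultiplicity_mul (mul_ne_zero hs hs), rootMultiplicity_C, rootMultiplicity_X_sub_C_self,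
    rootMultiplicity_eq_zero hgr] at h2
  omega

lemma weil (n : ℕ) (ε : ℝ) (hε : 0 < ε) : ∃ Q : ℕ, ∀ (F : Type) [Field F] [Fintype F] [DecidableEq F],
    Odd (Fintype.card F) → Q ≤ Fintype.card F → ∀ S : Finset F, S.Nonempty → (0:F) ∉ S → S.card ≤ n →
    |((∑ z : F, quadraticChar F (∏ c ∈ S, (1 + c * z)) : ℤ) : ℝ)| ≤ ε * Fintype.card F := by
  obtain ⟨M, hM⟩ := exists_nat_gt (n / ε)
  have hM0 : 0 < M := by
    have : (0:ℝ) < M := lt_of_le_of_lt (by positivity) hM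
    exact_mod_cast this
  set B := M * (M + 1 + 2 * n * M + 1) + 1 with hB
  obtain ⟨Q, hQ⟩ := exists_nat_gt (2 * (B + n) / ε)
  refine ⟨max Q (2 * B + n + 2 * M + 3), ?_⟩
  intro F _ _ _ hodd hcard S hS h0 hSn
  have hcQ := (le_max_left _ _).trans hcard
  have hcB := (le_max_right _ _).trans hcard
  obtain ⟨h, hh⟩ := hodd
  set q := Fintype.card F with hq
  set f : F[X] := ∏ c ∈ S, (1 + C c * X) with hf
  have hfe : ∀ z, f.eval z = ∏ c ∈ S, (1 + c * z) := by
    intro z; simp [hf, eval_prod]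
  have hfd : f.natDegree ≤ n := by
    refine (natDegree_prod_le _ _).trans (le_trans ?_ hSn)
    rw [Finset.card_eq_sum_ones]
    refine Finset.sum_le_sum fun c _ => ?_
    refine natDegree_add_le_of_degree_le (by simp) ((natDegree_C_mul_le _ _).trans natDegree_X_le)
  have hf0 : f.coeff 0 = 1 := by
    rw [coeff_zero_eq_eval_zero, hfe]; simp
  have hst := stepanov f hf0 (prod_nonsq S hS h0) h n B M hfd hh (by omega) (by omega) (by omega)
  have h1 := hst 1 one_ne_zero
  have h2 := hst (-1) (by simp)
  have hch : ringChar F ≠ 2 := by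
    intro hc
    have := FiniteField.even_card_of_char_two hc
    omega
  have hqc : ∀ z, ((quadraticChar F (f.eval z) : ℤ) : F) = (f.eval z) ^ h := by
    intro z
    rw [quadraticChar_eq_pow_of_char_ne_two' hch, ← hq, hh]
    congr 1; omega
  have hneg : (-1 : F) ≠ 1 := Ring.neg_one_ne_one_of_char_ne_two hch
  set N1 := (Finset.univ.filter fun z : F => (f.eval z) ^ h = 1).card with hN1
  set N2 := (Finset.univ.filter fun z : F => (f.eval z) ^ h = -1).card with hN2
  set N0 := (Finset.univ.filter fun z : F => f.eval z = 0).card with hN0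
  have hf_ne : f ≠ 0 := by
    intro h; rw [h] at hf0; simp at hf0
  have hN0n : N0 ≤ n := by
    refine le_trans ?_ ((card_roots' f).trans hfd)
    refine le_trans ?_ (Multiset.toFinset_card_le _)
    refine Finset.card_le_card fun z hz => ?_
    simp only [Finset.mem_filter, Finset.mem_univ, true_and] at hz
    simp [hf_ne, hz]
  have key : ∀ z, (quadraticChar F (f.eval z) = 
      (if (f.eval z) ^ h = 1 then 1 else 0) - (if (f.eval z) ^ h = -1 then 1 else 0)) ∧
      (1 : ℕ) = (if (f.eval z) ^ h = 1 then 1 else 0) + (if (f.eval z) ^ h = -1 then 1 else 0)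
       + (if f.eval z = 0 then 1 else 0) := by
    intro z
    have hz := hqc z
    have hhp : h ≠ 0 := by omega
    by_cases hz0 : f.eval z = 0
    · simp [hz0, hhp]
    · rcases quadraticChar_dichotomy hz0 with h3 | h3
      · rw [h3] at hz
        simp only [Int.cast_one] at hz
        rw [h3, ← hz]; simp [hz0, hneg.symm]
      · rw [h3] at hz
        simp only [Int.cast_neg, Int.cast_one] at hz
        rw [h3, ← hz]; simp [hz0, hneg]
  have hsum : (∑ z : F, quadraticChar F (∏ c ∈ S, (1 + c * z)) : ℤ) = N1 - N2 := by
    simp_rw [← hfe, (key _).1]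
    rw [Finset.sum_sub_distrib, Finset.sum_boole, Finset.sum_boole]
  have htot : q = N1 + N2 + N0 := by
    have : q = ∑ z : F, 1 := by simp [hq]
    rw [this, Finset.sum_congr rfl fun z _ => (key z).2, Finset.sum_add_distrib, Finset.sum_add_distrib]
    simp [N1, N2, N0]
  rw [hsum]
  push_cast
  have hM' : (0:ℝ) < M := by exact_mod_cast hM0
  have r1 : (N1:ℝ) * (2 * M) ≤ B + n * h + q * M := by exact_mod_cast h1
  have r2 : (N2:ℝ) * (2 * M) ≤ B + n * h + q * M := by exact_mod_cast h2
  have r3 : (q:ℝ) = N1 + N2 + N0 := by exact_mod_cast htot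
  have r4 : (q:ℝ) = 2 * h + 1 := by exact_mod_cast hh
  have r5 : (N0:ℝ) ≤ n := by exact_mod_cast hN0n
  have r6 : (n:ℝ) < M * ε := by rwa [div_lt_iff₀ hε] at hM
  have r7 : 2 * ((B:ℝ) + n) < q * ε := by
    rw [div_lt_iff₀ hε] at hQ
    have : (Q:ℝ) ≤ q := by exact_mod_cast hcQ
    nlinarith
  have r8 : (1:ℝ) ≤ M := by exact_mod_cast hM0
  have hn0 : (0:ℝ) ≤ n := by positivity
  have hh0 : (0:ℝ) ≤ h := by positivity
  have hB0 : (0:ℝ) ≤ B := by positivity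
  have r9 : (n:ℝ) * (2*h) ≤ M * ε * q := by
    have : (2*h:ℝ) ≤ q := by linarith
    have := mul_le_mul r6.le this (by positivity) (by positivity)
    exact this
  have r10 : 2 * ((B:ℝ) + n * M) ≤ M * (q * ε) := by nlinarith
  have r11 : (N0:ℝ) * M ≤ n * M := by nlinarith
  have e3 : (q:ℝ) * M = N1 * M + N2 * M + N0 * M := by rw [r3]; ring
  rw [abs_le]
  constructor
  · have : -(ε * q) * M ≤ (N1 - N2) * M := by linarith
    exact le_of_mul_le_mul_right this hM'
  · have : (N1 - N2) * M ≤ (ε * q) * M := by linarith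
    exact le_of_mul_le_mul_right this hM'

lemma bad_set (m : ℕ) : ∃ R : ℕ, ∀ (F : Type) [Field F] [Fintype F] [DecidableEq F],
    ∃ bad : Finset (Fin m → F), (bad.card : ℝ) * Fintype.card F ≤ R * (Fintype.card F : ℝ) ^ m ∧
      ∀ x ∉ bad, (∀ A B : Finset (Fin m), ∏ i ∈ A, x i = ∏ i ∈ B, x i → A = B) ∧
        (∀ A : Finset (Fin m), A.Nonempty → 1 + ∏ i ∈ A, x i ≠ 0) ∧ ∀ j, x j ≠ 0 := by
  classical
  set I := (Finset.univ : Finset (Finset (Fin m) × Finset (Fin m))).filter (fun p => p.1 ≠ p.2) with hI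
  set I' := (Finset.univ : Finset (Finset (Fin m))).filter (fun p => p.Nonempty) with hI'
  refine ⟨∑ p ∈ I, m + ∑ p ∈ I', m + ∑ j : Fin m, 1, ?_⟩
  intro F _ _ _
  let mo : Finset (Fin m) → MvPolynomial (Fin m) F := fun A => ∏ i ∈ A, MvPolynomial.X i
  have hmo : ∀ x A, MvPolynomial.eval x (mo A) = ∏ i ∈ A, x i := by
    intro x A; simp [mo, map_prod]
  have hmd : ∀ A, (mo A).totalDegree ≤ m := by
    intro A
    refine (MvPolynomial.totalDegree_finsetProd _ _).trans ?_
    simp only [MvPolynomial.totalDegree_X, Finset.sum_const, smul_eq_mul, mul_one]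
    simpa using Finset.card_le_univ A
  set D1 := ∏ p ∈ I, (mo p.1 - mo p.2) with hD1
  set D2 := ∏ p ∈ I', (1 + mo p) with hD2
  set D3 : MvPolynomial (Fin m) F := ∏ j : Fin m, MvPolynomial.X j with hD3
  have hD1d : D1.totalDegree ≤ ∑ p ∈ I, m := by
    refine (MvPolynomial.totalDegree_finsetProd _ _).trans (Finset.sum_le_sum fun p _ => ?_)
    exact (MvPolynomial.totalDegree_sub _ _).trans (max_le (hmd _) (hmd _))
  have hD2d : D2.totalDegree ≤ ∑ p ∈ I', m := by
    refine (MvPolynomial.totalDegree_finsetProd _ _).trans (Finset.sum_le_sum fun p _ => ?_)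
    exact (MvPolynomial.totalDegree_add _ _).trans (max_le (by simp) (hmd _))
  have hD3d : D3.totalDegree ≤ ∑ j : Fin m, 1 := by
    refine (MvPolynomial.totalDegree_finsetProd _ _).trans (Finset.sum_le_sum fun p _ => ?_)
    simp
  have hDd : (D1 * D2 * D3).totalDegree ≤ ∑ p ∈ I, m + ∑ p ∈ I', m + ∑ j : Fin m, 1 := by
    refine (MvPolynomial.totalDegree_mul _ _).trans (add_le_add ?_ hD3d)
    exact (MvPolynomial.totalDegree_mul _ _).trans (add_le_add hD1d hD2d)
  have hind : ∀ A B : Finset (Fin m), ∏ i ∈ A, (if i ∈ B then (1:F) else 0) = if A ⊆ B then 1 else 0 := by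
    intro A B
    rw [Finset.prod_ite_zero]
    simp [Finset.subset_iff]
  have hD1n : D1 ≠ 0 := by
    rw [hD1, Finset.prod_ne_zero_iff]
    rintro ⟨A, B⟩ hp h0
    rw [hI, Finset.mem_filter] at hp
    have h1 := congrArg (MvPolynomial.eval (fun i => if i ∈ A then (1:F) else 0)) h0
    have h2 := congrArg (MvPolynomial.eval (fun i => if i ∈ B then (1:F) else 0)) h0
    rw [map_sub, hmo, hmo, hind, hind, map_zero] at h1 h2
    by_cases hAB : A ⊆ B
    · by_cases hBA : B ⊆ A
      · exact hp.2 (Finset.Subset.antisymm hAB hBA)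
      · simp [hBA] at h1
    · simp [hAB] at h2
  have hD2n : D2 ≠ 0 := by
    rw [hD2, Finset.prod_ne_zero_iff]
    rintro A hp h0
    rw [hI', Finset.mem_filter] at hp
    have h1 := congrArg (MvPolynomial.eval (fun i => if i ∈ (∅ : Finset (Fin m)) then (1:F) else 0)) h0
    rw [map_add, hmo, hind, map_zero, if_neg] at h1
    · simp at h1
    · rw [Finset.subset_empty]; exact hp.2.ne_empty
  have hD3n : D3 ≠ 0 := by
    rw [hD3, Finset.prod_ne_zero_iff]
    exact fun j _ => MvPolynomial.X_ne_zero j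
  have hDn : D1 * D2 * D3 ≠ 0 := mul_ne_zero (mul_ne_zero hD1n hD2n) hD3n
  refine ⟨Finset.univ.filter fun x => MvPolynomial.eval x (D1 * D2 * D3) = 0, ?_, ?_⟩
  · have hsz := MvPolynomial.schwartz_zippel_totalDegree hDn (Finset.univ : Finset F)
    rw [Fintype.piFinset_univ, Finset.card_univ] at hsz
    have hq : (0:ℚ≥0) < (Fintype.card F : ℚ≥0) := by exact_mod_cast Fintype.card_pos
    rw [div_le_div_iff₀ (by positivity) hq] at hsz
    have hsz' : (Finset.univ.filter fun x => MvPolynomial.eval x (D1 * D2 * D3) = 0).card * Fintype.card F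
      ≤ (D1 * D2 * D3).totalDegree * Fintype.card F ^ m := by exact_mod_cast hsz
    have := hsz'.trans (Nat.mul_le_mul_right _ hDd)
    exact_mod_cast this
  · intro x hx
    simp only [Finset.mem_filter, Finset.mem_univ, true_and, map_mul, mul_eq_zero, not_or] at hx
    obtain ⟨⟨h1, h2⟩, h3⟩ := hx
    rw [hD1, map_prod, Finset.prod_eq_zero_iff] at h1
    rw [hD2, map_prod, Finset.prod_eq_zero_iff] at h2
    rw [hD3, map_prod, Finset.prod_eq_zero_iff] at h3
    refine ⟨?_, ?_, ?_⟩
    · intro A B hAB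
      by_contra hne
      exact h1 ⟨(A, B), by simp [hI, hne], by rw [map_sub, hmo, hmo, hAB, sub_self]⟩
    · intro A hA h0
      exact h2 ⟨A, by simp [hI', hA], by rw [map_add, hmo, map_one, h0]⟩
    · intro j hj
      exact h3 ⟨j, Finset.mem_univ _, by simp [hj]⟩

lemma sum_update {F : Type*} [Fintype F] {m : ℕ} (i : Fin m) (Ψ : (Fin m → F) → ℝ) :
    ∑ x : Fin m → F, ∑ z : F, Ψ (Function.update x i z) = Fintype.card F * ∑ x, Ψ x := by
  classical
  have h1 : ∑ p : (Fin m → F) × F, Ψ (Function.update p.1 i p.2) = ∑ p : (Fin m → F) × F, Ψ p.1 := by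
    refine Finset.sum_bij' (fun p _ => (Function.update p.1 i p.2, p.1 i))
      (fun p _ => (Function.update p.1 i p.2, p.1 i)) ?_ ?_ ?_ ?_ ?_ <;> simp
  rw [Fintype.sum_prod_type, Fintype.sum_prod_type] at h1
  rw [h1]
  simp [Finset.mul_sum]

lemma charsum {F : Type} [Field F] [Fintype F] [DecidableEq F] {m : ℕ} (ε : ℝ)
    (hε : 0 < ε)
    (hW : ∀ S : Finset F, S.Nonempty → (0:F) ∉ S → S.card ≤ 2 ^ m →
      |((∑ z : F, quadraticChar F (∏ c ∈ S, (1 + c * z)) : ℤ) : ℝ)| ≤ ε * Fintype.card F)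
    (bad : Finset (Fin m → F))
    (hbad : ∀ x ∉ bad, (∀ A B : Finset (Fin m), ∏ i ∈ A, x i = ∏ i ∈ B, x i → A = B) ∧
        (∀ A : Finset (Fin m), A.Nonempty → 1 + ∏ i ∈ A, x i ≠ 0) ∧ ∀ j, x j ≠ 0)
    (T : Finset (Finset (Fin m))) (hT : T.Nonempty) (hTn : ∀ S ∈ T, S.Nonempty) :
    |∑ x : Fin m → F, ∏ S ∈ T, ((quadraticChar F (1 + ∏ i ∈ S, x i) : ℤ) : ℝ)|
      ≤ ε * (Fintype.card F : ℝ) ^ m + bad.card := by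
  obtain ⟨S0, hS0⟩ := hT
  obtain ⟨i, hi⟩ := hTn S0 hS0
  have habs : ∀ a : F, |((quadraticChar F a : ℤ) : ℝ)| ≤ 1 := by
    intro a
    by_cases ha : a = 0
    · simp [ha]
    · rcases quadraticChar_dichotomy ha with h | h <;> rw [h] <;> simp
  have habsP : ∀ (T' : Finset (Finset (Fin m))) (g : Finset (Fin m) → F),
      |∏ S ∈ T', ((quadraticChar F (g S) : ℤ) : ℝ)| ≤ 1 := by
    intro T' g
    rw [Finset.abs_prod]
    exact Finset.prod_le_one (fun _ _ => abs_nonneg _) (fun _ _ => habs _)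
  have hq : (0:ℝ) < Fintype.card F := by exact_mod_cast Fintype.card_pos
  set Ψ : (Fin m → F) → ℝ := fun x => ∏ S ∈ T, ((quadraticChar F (1 + ∏ i ∈ S, x i) : ℤ) : ℝ) with hΨ
  have hinner : ∀ x, |∑ z : F, Ψ (Function.update x i z)| ≤
      ε * Fintype.card F + if x ∈ bad then (Fintype.card F : ℝ) else 0 := by
    intro x
    by_cases hx : x ∈ bad
    · rw [if_pos hx]
      have : |∑ z : F, Ψ (Function.update x i z)| ≤ ∑ z : F, (1:ℝ) :=
        (Finset.abs_sum_le_sum_abs _ _).trans (Finset.sum_le_sum fun z _ => habsP _ _)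
      simp only [Finset.sum_const, Finset.card_univ, nsmul_eq_mul, mul_one] at this
      have : 0 ≤ ε * Fintype.card F := by positivity
      linarith
    · rw [if_neg hx, add_zero]
      obtain ⟨hx1, -, hx3⟩ := hbad x hx
      set c : Finset (Fin m) → F := fun S => ∏ j ∈ S.erase i, x j with hc
      have hcinj : Set.InjOn c (T.filter (fun S => i ∈ S)) := by
        intro A hA B hB hAB
        simp only [Finset.coe_filter, Set.mem_ofPred_eq] at hA hB
        have := hx1 _ _ hAB
        rw [← Finset.insert_erase hA.2, this, Finset.insert_erase hB.2]
      have hsplit : ∀ z, Ψ (Function.update x i z) =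
          (∏ S ∈ T.filter (fun S => ¬ i ∈ S), ((quadraticChar F (1 + ∏ i ∈ S, x i) : ℤ) : ℝ)) *
          ((quadraticChar F (∏ d ∈ (T.filter (fun S => i ∈ S)).image c, (1 + d * z)) : ℤ) : ℝ) := by
        intro z
        rw [Finset.prod_image hcinj, map_prod, Int.cast_prod, hΨ]
        simp only
        rw [← Finset.prod_filter_not_mul_prod_filter T (fun S => i ∈ S)]
        congr 1
        · refine Finset.prod_congr rfl fun S hS => ?_
          rw [Finset.mem_filter] at hS
          rw [Finset.prod_update_of_notMem hS.2]
        · refine Finset.prod_congr rfl fun S hS => ?_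
          rw [Finset.mem_filter] at hS
          rw [Finset.prod_update_of_mem hS.2, Finset.sdiff_singleton_eq_erase, mul_comm]
      simp_rw [hsplit]
      rw [← Finset.mul_sum, abs_mul]
      have h1 := habsP (T.filter (fun S => ¬ i ∈ S)) (fun S => 1 + ∏ i ∈ S, x i)
      have h2 := hW ((T.filter (fun S => i ∈ S)).image c)
        (Finset.Nonempty.image ⟨S0, by simp [hS0, hi]⟩ _) ?_ ?_
      · rw [Int.cast_sum] at h2
        calc _ ≤ 1 * _ := mul_le_mul_of_nonneg_right h1 (abs_nonneg _)
          _ ≤ _ := by rw [one_mul]; exact h2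
      · rw [Finset.mem_image]
        rintro ⟨S, -, hS⟩
        rw [hc] at hS
        simp only [Finset.prod_eq_zero_iff] at hS
        obtain ⟨j, -, hj⟩ := hS
        exact hx3 j hj
      · refine Finset.card_image_le.trans ((Finset.card_le_univ _).trans ?_)
        simp
  have hs := sum_update i Ψ
  have : Fintype.card F * |∑ x, Ψ x| ≤ Fintype.card F * (ε * (Fintype.card F : ℝ) ^ m + bad.card) := by
    calc (Fintype.card F : ℝ) * |∑ x, Ψ x| = |∑ x : Fin m → F, ∑ z : F, Ψ (Function.update x i z)| := by
          rw [hs, abs_mul, abs_of_pos hq]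
      _ ≤ ∑ x : Fin m → F, (ε * Fintype.card F + if x ∈ bad then (Fintype.card F : ℝ) else 0) :=
          (Finset.abs_sum_le_sum_abs _ _).trans (Finset.sum_le_sum fun x _ => hinner x)
      _ = _ := by
          rw [Finset.sum_add_distrib, Finset.sum_ite_mem]
          simp
          ring
  exact le_of_mul_le_mul_left this hq

lemma fiber_card {F : Type} [Fintype F] [DecidableEq F] {m : ℕ} (A : Finset F) (hA : A.card = m) :
    (Finset.univ.filter fun x : Fin m → F => Function.Injective x ∧ Finset.univ.image x = A).card
      = m.factorial := by
  have h1 : Fintype.card (Fin m ≃ A) = m.factorial := by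
    rw [Fintype.card_equiv (Fintype.equivOfCardEq (by simp [hA])), Fintype.card_fin]
  rw [← h1, ← Finset.card_univ]
  symm
  refine Finset.card_bij (fun e _ j => (e j : F)) ?_ ?_ ?_
  · intro e _
    simp only [Finset.mem_filter, Finset.mem_univ, true_and]
    refine ⟨Subtype.val_injective.comp e.injective, ?_⟩
    ext a
    simp only [Finset.mem_image, Finset.mem_univ, true_and]
    constructor
    · rintro ⟨j, rfl⟩; exact (e j).2
    · intro ha; exact ⟨e.symm ⟨a, ha⟩, by simp⟩
  · intro e _ e' _ h
    ext j
    exact congrFun h j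
  · intro x hx
    simp only [Finset.mem_filter, Finset.mem_univ, true_and] at hx
    have hmem : ∀ j, x j ∈ A := fun j => hx.2 ▸ Finset.mem_image_of_mem _ (Finset.mem_univ _)
    refine ⟨Equiv.ofBijective (fun j => (⟨x j, hmem j⟩ : A)) ⟨?_, ?_⟩, Finset.mem_univ _, ?_⟩
    · intro a b hab
      exact hx.1 (congrArg Subtype.val hab)
    · rintro ⟨a, ha⟩
      rw [← hx.2] at ha
      obtain ⟨j, -, hj⟩ := Finset.mem_image.mp ha
      exact ⟨j, Subtype.ext hj⟩
    · funext j; rfl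

lemma cond_iff {F : Type} [Field F] [Fintype F] [DecidableEq F] {m k : ℕ} (x : Fin m → F)
    (hx : Function.Injective x) :
    (∀ a : Fin k → F, Function.Injective a → (∀ i, a i ∈ Finset.univ.image x) →
      IsSquare ((∏ i, a i) + 1)) ↔
    ∀ S ∈ Finset.powersetCard k (Finset.univ : Finset (Fin m)), IsSquare (1 + ∏ i ∈ S, x i) := by
  constructor
  · intro h S hS
    rw [Finset.mem_powersetCard] at hS
    have := h (fun j => x (S.orderEmbOfFin hS.2 j)) (hx.comp (S.orderEmbOfFin hS.2).injective)
      (fun j => Finset.mem_image_of_mem _ (Finset.mem_univ _))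
    rw [add_comm]
    convert this using 2
    conv_lhs => rw [← Finset.image_orderEmbOfFin_univ S hS.2]
    rw [Finset.prod_image]
    intro a _ b _ hab
    exact (S.orderEmbOfFin hS.2).injective hab
  · intro h a ha hmem
    simp only [Finset.mem_image, Finset.mem_univ, true_and] at hmem
    choose σ hσ using hmem
    have hσi : Function.Injective σ := by
      intro i j hij
      apply ha
      rw [← hσ, ← hσ, hij]
    have := h (Finset.univ.image σ) (by
      rw [Finset.mem_powersetCard]
      exact ⟨Finset.subset_univ _, by rw [Finset.card_image_of_injective _ hσi]; simp⟩)
    rw [Finset.prod_image (fun a _ b _ hab => hσi hab), add_comm] at this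
    simpa [hσ] using this

lemma count_eq {F : Type} [Field F] [Fintype F] [DecidableEq F] (k m : ℕ) 
    [DecidablePred fun x : Fin m → F => (Function.Injective x ∧
      ∀ S ∈ Finset.powersetCard k (Finset.univ : Finset (Fin m)), IsSquare (1 + ∏ i ∈ S, x i))] :
    (Finset.univ.filter fun x : Fin m → F => (Function.Injective x ∧
      ∀ S ∈ Finset.powersetCard k (Finset.univ : Finset (Fin m)), IsSquare (1 + ∏ i ∈ S, x i))).card
     = kDiophCount F k m * m.factorial := by
  classical
  rw [kDiophCount, Set.ncard_eq_toFinset_card']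
  rw [Finset.card_eq_sum_card_fiberwise (f := fun x => Finset.univ.image x)
    (t := Set.toFinset {A : Finset F | A.card = m ∧
    ∀ a : Fin k → F, Function.Injective a → (∀ i, a i ∈ A) →
      IsSquare ((∏ i, a i) + 1)})]
  · rw [Finset.sum_const_nat]
    intro A hA
    rw [Set.mem_toFinset, Set.mem_ofPred_eq] at hA
    rw [← fiber_card A hA.1]
    congr 1
    ext x
    simp only [Finset.mem_filter, Finset.mem_univ, true_and]
    constructor
    · rintro ⟨⟨h1, -⟩, h3⟩; exact ⟨h1, h3⟩
    · rintro ⟨h1, h3⟩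
      refine ⟨⟨h1, ?_⟩, h3⟩
      rw [← cond_iff x h1, h3]
      exact hA.2
  · intro x hx
    simp only [Finset.coe_filter, Finset.mem_univ, true_and, Set.mem_ofPred_eq] at hx
    simp only [Set.coe_toFinset, Set.mem_ofPred_eq]
    refine ⟨by rw [Finset.card_image_of_injective _ hx.1]; simp, ?_⟩
    exact (cond_iff x hx.1).mpr hx.2

theorem stmt_3 (k m : ℕ) (hk : 2 ≤ k) (hkm : k ≤ m) :
    ∀ ε : ℝ, 0 < ε → ∃ Q : ℕ, 0 < Q ∧
      ∀ (q : ℕ) (F : Type) [Field F] [Fintype F],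
        Fintype.card F = q → Odd q → Q ≤ q →
          |(kDiophCount F k m : ℝ) -
              (q : ℝ) ^ m / ((m.factorial : ℝ) * 2 ^ (m.choose k))| ≤ ε * (q : ℝ) ^ m := by
  intro ε hε
  obtain ⟨Q1, hQ1⟩ := weil (2 ^ m) (ε / 2) (by positivity)
  obtain ⟨R, hR⟩ := bad_set m
  obtain ⟨Q2, hQ2⟩ := exists_nat_gt (4 * R / ε)
  refine ⟨Q1 + Q2 + 1, by omega, ?_⟩
  intro q F _ _ hq hodd hQq
  classical
  subst hq
  set q := Fintype.card F with hq
  have hW := hQ1 F hodd (by omega)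
  obtain ⟨bad, hbc, hbad⟩ := hR F
  have hq0 : (0:ℝ) < q := by exact_mod_cast Fintype.card_pos
  have hbad4 : (bad.card : ℝ) ≤ ε / 4 * q ^ m := by
    have h1 : (Q2:ℝ) ≤ q := by exact_mod_cast (by omega : Q2 ≤ q)
    rw [div_lt_iff₀ hε] at hQ2
    have h2 : (R:ℝ) ≤ ε / 4 * q := by nlinarith
    have h3 : (bad.card : ℝ) * q ≤ (ε / 4 * q ^ m) * q := by
      calc _ ≤ _ := hbc
        _ ≤ (ε / 4 * q) * (q:ℝ) ^ m := mul_le_mul_of_nonneg_right h2 (by positivity)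
        _ = _ := by ring
    exact le_of_mul_le_mul_right h3 hq0
  set U := Finset.powersetCard k (Finset.univ : Finset (Fin m)) with hU
  have hUc : U.card = m.choose k := by simp [hU]
  have hUn : ∀ S ∈ U, S.Nonempty := by
    intro S hS
    rw [hU, Finset.mem_powersetCard] at hS
    rw [← Finset.card_pos]; omega
  have hcs := fun T hT hTn => charsum (m := m) (ε/2) (by positivity) hW bad hbad T hT hTn
  let P : (Fin m → F) → Prop := fun x => Function.Injective x ∧ ∀ S ∈ U, IsSquare (1 + ∏ i ∈ S, x i)
  let w : (Fin m → F) → Finset (Fin m) → ℝ := fun x S => ((quadraticChar F (1 + ∏ i ∈ S, x i) : ℤ) : ℝ)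
  let Φ : (Fin m → F) → ℝ := fun x => ∏ S ∈ U, (1 + w x S) / 2
  have hw : ∀ x S, w x S = 0 ∨ w x S = 1 ∨ w x S = -1 := by
    intro x S
    by_cases ha : 1 + ∏ i ∈ S, x i = 0
    · left; simp [w, ha]
    · right
      rcases quadraticChar_dichotomy ha with h | h
      · left; simp only [w]; rw [h]; simp
      · right; simp only [w]; rw [h]; simp
  have hΦ : ∀ x, |(if P x then (1:ℝ) else 0) - Φ x| ≤ if x ∈ bad then 1 else 0 := by
    intro x
    split_ifs with h1 h2 h2
    · have b1 : 0 ≤ Φ x := Finset.prod_nonneg fun S _ => by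
        rcases hw x S with h | h | h <;> rw [h] <;> norm_num
      have b2 : Φ x ≤ 1 := Finset.prod_le_one (fun S _ => by
        rcases hw x S with h | h | h <;> rw [h] <;> norm_num) (fun S _ => by
        rcases hw x S with h | h | h <;> rw [h] <;> norm_num)
      rw [abs_le]; constructor <;> linarith
    · have : Φ x = 1 := by
        refine Finset.prod_eq_one fun S hS => ?_
        have hne := (hbad x h2).2.1 S (hUn S hS)
        have : w x S = 1 := by
          simp only [w]
          rw [(quadraticChar_one_iff_isSquare hne).mpr (h1.2 S hS)]; simp
        rw [this]; norm_num
      rw [this]; simp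
    · have b1 : 0 ≤ Φ x := Finset.prod_nonneg fun S _ => by
        rcases hw x S with h | h | h <;> rw [h] <;> norm_num
      have b2 : Φ x ≤ 1 := Finset.prod_le_one (fun S _ => by
        rcases hw x S with h | h | h <;> rw [h] <;> norm_num) (fun S _ => by
        rcases hw x S with h | h | h <;> rw [h] <;> norm_num)
      rw [abs_le]; constructor <;> linarith
    · have hinj : Function.Injective x := by
        intro i j hij
        have := (hbad x h2).1 {i} {j} (by simpa using hij)
        simpa using this
      have : ∃ S ∈ U, ¬ IsSquare (1 + ∏ i ∈ S, x i) := by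
        by_contra hcon
        push Not at hcon
        exact h1 ⟨hinj, hcon⟩
      obtain ⟨S, hS, hns⟩ := this
      have : Φ x = 0 := by
        refine Finset.prod_eq_zero hS ?_
        have : w x S = -1 := by
          simp only [w]
          rw [quadraticChar_neg_one_iff_not_isSquare.mpr hns]; simp
        rw [this]; norm_num
      rw [this]; simp
  have hN : ((kDiophCount F k m : ℝ) * m.factorial) = ∑ x, if P x then (1:ℝ) else 0 := by
    rw [Finset.sum_boole]
    have := count_eq (F := F) k m
    rw [← Nat.cast_mul, ← this]
  have h1 : |(kDiophCount F k m : ℝ) * m.factorial - ∑ x, Φ x| ≤ bad.card := by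
    rw [hN, ← Finset.sum_sub_distrib]
    refine (Finset.abs_sum_le_sum_abs _ _).trans ((Finset.sum_le_sum fun x _ => hΦ x).trans ?_)
    simp
  have h2 : ∑ x, Φ x = (∑ T ∈ U.powerset, ∑ x, ∏ S ∈ T, w x S) / 2 ^ (m.choose k) := by
    rw [Finset.sum_comm, Finset.sum_div]
    refine Finset.sum_congr rfl fun x _ => ?_
    simp only [Φ]
    rw [Finset.prod_div_distrib, Finset.prod_const, hUc, Finset.prod_one_add]
  have h3 : |∑ x, Φ x - (q:ℝ) ^ m / 2 ^ (m.choose k)| ≤ ε / 2 * q ^ m + bad.card := by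
    rw [h2, ← sub_div, abs_div, abs_of_pos (by positivity : (0:ℝ) < 2 ^ (m.choose k)),
      div_le_iff₀ (by positivity)]
    rw [← Finset.sum_erase_add _ _ (Finset.empty_mem_powerset U)]
    have : ∑ x : Fin m → F, ∏ S ∈ (∅ : Finset (Finset (Fin m))), w x S = (q:ℝ) ^ m := by
      simp [hq]
    rw [this, add_sub_cancel_right]
    refine (Finset.abs_sum_le_sum_abs _ _).trans ?_
    refine (Finset.sum_le_sum (g := fun _ => ε / 2 * (q:ℝ) ^ m + bad.card) fun T hT => ?_).trans ?_
    · rw [Finset.mem_erase, Finset.mem_powerset] at hT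
      exact hcs T (Finset.nonempty_iff_ne_empty.mpr hT.1) (fun S hS => hUn S (hT.2 hS))
    · rw [Finset.sum_const, nsmul_eq_mul, mul_comm]
      refine mul_le_mul_of_nonneg_left ?_ (by positivity)
      have := (Finset.card_erase_le (s := U.powerset) (a := ∅))
      rw [Finset.card_powerset, hUc] at this
      exact_mod_cast this
  have h4 : |(kDiophCount F k m : ℝ) * m.factorial - (q:ℝ) ^ m / 2 ^ (m.choose k)| ≤ ε * q ^ m := by
    have := abs_sub_le ((kDiophCount F k m : ℝ) * m.factorial) (∑ x, Φ x) ((q:ℝ) ^ m / 2 ^ (m.choose k))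
    linarith
  have hfac : (1:ℝ) ≤ m.factorial := by exact_mod_cast Nat.one_le_iff_ne_zero.mpr (Nat.factorial_ne_zero m)
  have e : (kDiophCount F k m : ℝ) - (q : ℝ) ^ m / ((m.factorial : ℝ) * 2 ^ (m.choose k)) =
     ((kDiophCount F k m : ℝ) * m.factorial - (q:ℝ) ^ m / 2 ^ (m.choose k)) / m.factorial := by
    field_simp
  rw [e, abs_div, abs_of_pos (by linarith : (0:ℝ) < m.factorial), div_le_iff₀ (by linarith)]
  have : 0 ≤ ε * (q:ℝ) ^ m := by positivity
  nlinarith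
end

section
/- Let k ≥ 2 be a fixed integer. There exists a constant C > 0, depending only on k, such that for every odd prime power q, every integer d ≥ 1, every admissible symmetric polynomial f ∈ F_q[x_1,…,x_k] of total degree d, and every integer m ≥ k, the number of f-Diophantine sets A ⊆ F_q with |A| = m differs from q^m / (m! · 2^{binom(m,k)}) by at most C·((2d)^{2·binom(m,k)}·q^{m−1/2} + (2d)^{13·binom(m,k)/3}·q^{m−1}). -/
open MvPolynomial

/-- Substitute: variable `0` of `f` is kept as the polynomial indeterminate `X`, and
variable `j+1` is replaced by `u j`. -/
noncomputable def substX {F : Type*} [Field F] {k : ℕ} (f : MvPolynomial (Fin k) F)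
    (u : Fin (k - 1) → F) : Polynomial F :=
  MvPolynomial.aeval (fun i : Fin k =>
    if h : (i : ℕ) = 0 then (Polynomial.X : Polynomial F)
    else Polynomial.C (u ⟨(i : ℕ) - 1, by have := i.isLt; omega⟩)) f

/-- `f` is admissible: not a constant multiple of a square, and the coefficients of `f` as
a polynomial in `x_1` have no common zero over the algebraic closure. -/
def Admissible {F : Type*} [Field F] {k : ℕ} (f : MvPolynomial (Fin k) F) : Prop :=
  (¬ ∃ (c : F) (g : MvPolynomial (Fin k) F), f = MvPolynomial.C c * g ^ 2) ∧
  ∀ v : Fin (k - 1) → AlgebraicClosure F,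
    substX (MvPolynomial.map (algebraMap F (AlgebraicClosure F)) f) v ≠ 0

/-- `A` is an `f`-Diophantine set: `f(a_1,…,a_k)` is a square in `F_q` whenever
`a_1,…,a_k` are distinct elements of `A`. -/
def IsfDiophantine {F : Type*} [Field F] {k : ℕ} (f : MvPolynomial (Fin k) F)
    (A : Finset F) : Prop :=
  ∀ a : Fin k → F, Function.Injective a → (∀ i, a i ∈ A) →
    IsSquare (MvPolynomial.eval a f)

open MvPolynomial

namespace Polynomial

theorem dvd_hasse {F : Type*} [Field F] (f : F[X]) (n : ℕ) :
    ∀ j, f ^ (n - j) ∣ hasseDeriv j (f ^ n) := by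
  induction n with
  | zero => intro j; simp
  | succ n ih =>
    intro j
    rw [pow_succ', hasseDeriv_mul]
    refine Finset.dvd_sum fun ij hij => ?_
    have h := Finset.HasAntidiagonal.mem_antidiagonal.1 hij
    rcases Nat.eq_zero_or_pos ij.1 with h0 | h0
    · have : ij.2 = j := by omega
      rw [h0, hasseDeriv_zero', this]
      calc f ^ (n + 1 - j) ∣ f ^ (n - j + 1) := pow_dvd_pow _ (by omega)
        _ = f * f ^ (n - j) := pow_succ' _ _
        _ ∣ _ := mul_dvd_mul_left _ (ih j)
    · exact Dvd.dvd.mul_left ((pow_dvd_pow f (by omega)).trans (ih ij.2)) _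

theorem exists_W {F : Type*} [Field F] (f : F[X]) (hf : f ≠ 0) (m n : ℕ) (hm : f.natDegree ≤ m) :
    ∃ w : ℕ → F[X], ∀ j ≤ n, hasseDeriv j (f ^ n) = w j * f ^ (n - j) ∧
      (w j).natDegree ≤ j * m := by
  choose w hw using fun j => dvd_hasse f n j
  refine ⟨w, fun j hj => ⟨by rw [hw j, mul_comm], ?_⟩⟩
  by_cases h0 : w j = 0
  · simp [h0]
  have h1 := natDegree_hasseDeriv_le (f ^ n) j
  rw [hw j, natDegree_mul (pow_ne_zero _ hf) h0, natDegree_pow, natDegree_pow] at h1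
  have : n * f.natDegree = (n - j) * f.natDegree + j * f.natDegree := by
    rw [← add_mul]; congr 1; omega
  have h3 : j * f.natDegree ≤ j * m := Nat.mul_le_mul_left _ hm
  omega

/-- the linear operator `U` with `D^k (r f^n) = U r * f^(n-k)`. -/
theorem exists_U {F : Type*} [Field F] (f : F[X]) (hf : f ≠ 0) (m n k : ℕ) (hm : f.natDegree ≤ m)
    (hk : k ≤ n) :
    ∃ U : F[X] →ₗ[F] F[X], ∀ r, hasseDeriv k (r * f ^ n) = U r * f ^ (n - k) ∧
      (U r).natDegree ≤ r.natDegree + k * m := by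
  obtain ⟨w, hw⟩ := exists_W f hf m n hm
  refine ⟨∑ ij ∈ Finset.HasAntidiagonal.antidiagonal k,
    (LinearMap.mulRight F (w ij.2 * f ^ ij.1)) ∘ₗ (hasseDeriv ij.1), fun r => ⟨?_, ?_⟩⟩
  · rw [hasseDeriv_mul, LinearMap.sum_apply, Finset.sum_mul]
    refine Finset.sum_congr rfl fun ij hij => ?_
    have h := Finset.HasAntidiagonal.mem_antidiagonal.1 hij
    rw [(hw ij.2 (by omega)).1]
    simp only [LinearMap.comp_apply, LinearMap.mulRight_apply]
    have : n - ij.2 = ij.1 + (n - k) := by omega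
    rw [this, pow_add]; ring
  · rw [LinearMap.sum_apply]
    refine natDegree_sum_le_of_forall_le _ _ fun ij hij => ?_
    have h := Finset.HasAntidiagonal.mem_antidiagonal.1 hij
    simp only [LinearMap.comp_apply, LinearMap.mulRight_apply]
    refine natDegree_mul_le.trans ?_
    have h1 := natDegree_hasseDeriv_le r ij.1
    have h2 := (hw ij.2 (by omega)).2
    have h3 : (w ij.2 * f ^ ij.1).natDegree ≤ ij.2 * m + ij.1 * m := by
      refine natDegree_mul_le.trans (add_le_add h2 (natDegree_pow_le.trans (Nat.mul_le_mul_left _ hm)))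
    have : k * m = ij.2 * m + ij.1 * m := by rw [← h]; ring
    omega

theorem key_zero {F : Type*} [Field F] [Fintype F] (f : F[X]) (hodd : Odd (Fintype.card F))
    (H : ∀ (r s : F[X]) (c : F), c ≠ 0 → r ^ 2 * f = C c * s ^ 2 → r = 0)
    (a0 : F) (ha0 : f.eval a0 ≠ 0) (n m : ℕ) (hm : f.natDegree ≤ m)
    (hmq : m < Fintype.card F) (hn : 2 * n + m ≤ Fintype.card F) (r s : F[X]) (hr : r.degree < n) (hs : s.degree < n)
    (h : (X - C a0) ^ (Fintype.card F) ∣ r + s * f ^ ((Fintype.card F - 1) / 2)) :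
    r = 0 ∧ s = 0 := by
  set q := Fintype.card F with hq
  have hq1 : 1 < q := Fintype.one_lt_card
  have hdeg : ∀ r : F[X], r.degree < n → 2 * r.natDegree + m < q := by
    intro r hr
    by_cases h0 : r = 0
    · subst h0
      simpa using hmq
    · rw [degree_eq_natDegree h0] at hr
      have : r.natDegree < n := by exact_mod_cast hr
      omega
  have hpow : (X - C a0) ^ q ∣ f ^ q - C (f.eval a0) := by
    have h1 : f ^ q - C (f.eval a0) = (f - C (f.eval a0)) ^ q := by
      obtain ⟨p, hp⟩ := CharP.exists F
      haveI := hp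
      obtain ⟨t, hp', ht⟩ := FiniteField.card F p
      haveI := Fact.mk hp'
      rw [hq, ht, sub_pow_char_pow, ← ht, ← C_pow, FiniteField.pow_card]
    rw [h1]
    exact pow_dvd_pow_of_dvd (dvd_iff_isRoot.2 (by simp)) _
  have hd : (X - C a0) ^ q ∣ r ^ 2 * f - C (f.eval a0) * s ^ 2 := by
    have e1 : r ^ 2 * f - C (f.eval a0) * s ^ 2 =
      (r + s * f ^ ((q - 1) / 2)) * ((r - s * f ^ ((q - 1) / 2)) * f) +
        (f ^ q - C (f.eval a0)) * s ^ 2 := by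
      have : f ^ q = (f ^ ((q - 1) / 2)) ^ 2 * f := by
        rw [← pow_mul, ← pow_succ]; congr 1
        obtain ⟨t, ht⟩ := hodd
        omega
      rw [this]; ring
    rw [e1]
    exact dvd_add (Dvd.dvd.mul_right h _) (Dvd.dvd.mul_right hpow _)
  have hz : r ^ 2 * f - C (f.eval a0) * s ^ 2 = 0 := by
    by_contra hne
    have := natDegree_le_of_dvd hd hne
    rw [natDegree_pow, natDegree_X_sub_C, mul_one] at this
    have h2 : (r ^ 2 * f - C (f.eval a0) * s ^ 2).natDegree < q := by
      refine lt_of_le_of_lt (natDegree_sub_le _ _) (max_lt ?_ ?_)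
      · refine lt_of_le_of_lt (natDegree_mul_le.trans (add_le_add natDegree_pow_le hm)) (hdeg r hr)
      · refine lt_of_le_of_lt (natDegree_C_mul_le _ _) (lt_of_le_of_lt natDegree_pow_le ?_)
        have := hdeg s hs; omega
    omega
  have hr0 := H r s _ ha0 (sub_eq_zero.1 hz)
  refine ⟨hr0, ?_⟩
  rw [hr0] at hz
  simpa [ha0] using hz

theorem nonvanish {F : Type*} [Field F] [Fintype F] (f : F[X]) (hodd : Odd (Fintype.card F))
    (H : ∀ (r s : F[X]) (c : F), c ≠ 0 → r ^ 2 * f = C c * s ^ 2 → r = 0)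
    (a0 : F) (ha0 : f.eval a0 ≠ 0) (n m : ℕ) (hm : f.natDegree ≤ m)
    (hmq : m < Fintype.card F) (hn : 2 * n + m ≤ Fintype.card F) (J : ℕ) : ∀ (r s : ℕ → F[X]) (hr : ∀ j, (r j).degree < n)
    (hs : ∀ j, (s j).degree < n)
    (h : ∑ j ∈ Finset.range J, (r j + s j * f ^ ((Fintype.card F - 1) / 2)) *
      ((X - C a0) ^ j) ^ (Fintype.card F) = 0),
    ∀ j < J, r j = 0 ∧ s j = 0 := by
  induction J with
  | zero => intro r s hr hs h j hj; omega
  | succ J ih =>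
    intro r s hr hs h
    rw [Finset.sum_range_succ'] at h
    have e : ∑ j ∈ Finset.range J, (r (j+1) + s (j+1) * f ^ ((Fintype.card F - 1) / 2)) *
      ((X - C a0) ^ (j+1)) ^ (Fintype.card F) = (X - C a0) ^ (Fintype.card F) *
      ∑ j ∈ Finset.range J, (r (j+1) + s (j+1) * f ^ ((Fintype.card F - 1) / 2)) *
      ((X - C a0) ^ j) ^ (Fintype.card F) := by
      rw [Finset.mul_sum]
      refine Finset.sum_congr rfl fun j _ => ?_
      rw [pow_succ, mul_pow]; ring
    rw [e] at h
    have h0 := key_zero f hodd H a0 ha0 n m hm hmq hn (r 0) (s 0) (hr 0) (hs 0) (by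
      refine ⟨-∑ j ∈ Finset.range J, (r (j+1) + s (j+1) * f ^ ((Fintype.card F - 1) / 2)) *
        ((X - C a0) ^ j) ^ (Fintype.card F), ?_⟩
      have := eq_neg_of_add_eq_zero_right h
      simp only [pow_zero, one_pow, mul_one] at this
      rw [this]; ring)
    rw [h0.1, h0.2] at h
    simp only [zero_mul, add_zero] at h
    have h1 := (mul_eq_zero.1 h).resolve_left (pow_ne_zero _ (X_sub_C_ne_zero a0))
    have h2 := ih (fun j => r (j+1)) (fun j => s (j+1)) (fun j => hr _) (fun j => hs _) h1
    intro j hj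
    cases j with
    | zero => exact h0
    | succ j => exact h2 j (by omega)

theorem hasse_frob {F : Type*} [Field F] [Fintype F] (h w : F[X]) (k : ℕ)
    (hk : k < Fintype.card F) (x : F) :
    (hasseDeriv k (h * w ^ Fintype.card F)).eval x = (hasseDeriv k h).eval x * w.eval x := by
  rw [← taylor_coeff, ← taylor_coeff, taylor_mul, taylor_pow, ← FiniteField.expand_card]
  rw [coeff_mul, Finset.sum_eq_single (k, 0)]
  · rw [show (k, 0).2 = 0 from rfl, show (k,0).1 = k from rfl, coeff_expand Fintype.card_pos]; simp [taylor_coeff_zero]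
  · rintro ⟨i, j⟩ hij hne
    have hh := Finset.HasAntidiagonal.mem_antidiagonal.1 hij
    simp only at hh ⊢
    rw [coeff_expand Fintype.card_pos, if_neg, mul_zero]
    intro hd
    have : j = 0 := Nat.eq_zero_of_dvd_of_lt hd (by omega)
    apply hne; ext <;> simp <;> omega
  · intro hh; exact absurd (Finset.HasAntidiagonal.mem_antidiagonal.2 (by simp)) hh

end Polynomial

open MvPolynomial

namespace Polynomial

theorem stepanov_count {F : Type*} [Field F] [Fintype F] [DecidableEq F] (f : F[X])
    (hodd : Odd (Fintype.card F))
    (H : ∀ (r s : F[X]) (c : F), c ≠ 0 → r ^ 2 * f = C c * s ^ 2 → r = 0)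
    (a0 : F) (ha0 : f.eval a0 ≠ 0) (n m : ℕ) (hm : f.natDegree ≤ m)
    (hmq : m < Fintype.card F) (hn : 2 * n + m ≤ Fintype.card F) (J l : ℕ)
    (hl : l ≤ Fintype.card F) (hlin : l * (n + l * m + J) < 2 * (J * n)) (a : F) :
    l * (Finset.univ.filter fun x : F => (f.eval x) ^ ((Fintype.card F - 1) / 2) = a).card ≤
      l * m + n + m * ((Fintype.card F - 1) / 2) + J * Fintype.card F := by
  set q := Fintype.card F with hq
  set g := (q - 1) / 2 with hg
  have hf : f ≠ 0 := by rintro rfl; simp at ha0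
  choose U hU using fun k : Fin l => exists_U f hf m l k hm k.2.le
  choose V hV using fun k : Fin l => exists_U f hf m (l + g) k hm (by have := k.2; omega)
  let Q : Fin l → ((Fin J → degreeLT F n) × (Fin J → degreeLT F n)) →ₗ[F] F[X] := fun k =>
    ∑ j : Fin J, (LinearMap.mulRight F ((X - C a0) ^ (j : ℕ))) ∘ₗ
      ((U k) ∘ₗ (degreeLT F n).subtype ∘ₗ (LinearMap.proj j) ∘ₗ (LinearMap.fst F _ _) +
       a • (V k) ∘ₗ (degreeLT F n).subtype ∘ₗ (LinearMap.proj j) ∘ₗ (LinearMap.snd F _ _))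
  have hQ : ∀ k v, Q k v = ∑ j : Fin J, (U k (v.1 j) + a • V k (v.2 j)) * (X - C a0) ^ (j : ℕ) := by
    intro k v
    simp [Q, LinearMap.sum_apply]
  let Φ : ((Fin J → degreeLT F n) × (Fin J → degreeLT F n)) →ₗ[F]
      (Fin l × Fin (n + l * m + J) → F) :=
    LinearMap.pi fun i => (lcoeff F i.2) ∘ₗ Q i.1
  have hrank : Module.finrank F (Fin l × Fin (n + l * m + J) → F) <
      Module.finrank F ((Fin J → degreeLT F n) × (Fin J → degreeLT F n)) := by
    have e : Module.finrank F (degreeLT F n) = n := by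
      rw [(degreeLTEquiv F n).finrank_eq]; simp
    have : FiniteDimensional F (degreeLT F n) := (degreeLTEquiv F n).symm.finiteDimensional
    rw [Module.finrank_prod, Module.finrank_pi_fintype F (M := fun _ : Fin J => degreeLT F n),
      Module.finrank_fintype_fun_eq_card]
    simp only [e, Fintype.card_prod, Fintype.card_fin,
      Finset.sum_const, Finset.card_univ, smul_eq_mul]
    omega
  have : FiniteDimensional F (degreeLT F n) := (degreeLTEquiv F n).symm.finiteDimensional
  obtain ⟨v, hv, hv0⟩ := Submodule.exists_mem_ne_zero_of_ne_bot
    (LinearMap.ker_ne_bot_of_finrank_lt (f := Φ) hrank)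
  have hdl : ∀ w : degreeLT F n, (w : F[X]).natDegree ≤ n := fun w =>
    natDegree_le_of_degree_le (mem_degreeLT.1 w.2).le
  have hQ0 : ∀ k, Q k v = 0 := by
    intro k
    have hkl : (k : ℕ) + 1 ≤ l := k.2
    have hdeg : (Q k v).natDegree ≤ n + (l - 1) * m + (J - 1) := by
      rw [hQ]
      refine natDegree_sum_le_of_forall_le _ _ fun j _ => ?_
      have hk : (k : ℕ) * m ≤ (l - 1) * m := Nat.mul_le_mul_right _ (by omega)
      refine natDegree_mul_le.trans (add_le_add ?_ ?_)
      · refine (natDegree_add_le _ _).trans (max_le ?_ ?_)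
        · have := (hU k (v.1 j)).2; have := hdl (v.1 j); omega
        · refine (natDegree_smul_le _ _).trans ?_
          have := (hV k (v.2 j)).2; have := hdl (v.2 j); omega
      · rw [natDegree_pow, natDegree_X_sub_C]; omega
    ext i
    rw [coeff_zero]
    by_cases hi : i < n + l * m + J
    · have := congrFun (LinearMap.mem_ker.1 hv) (k, ⟨i, hi⟩)
      simpa [Φ] using this
    · refine coeff_eq_zero_of_natDegree_lt ?_
      have : (l - 1) * m ≤ l * m := Nat.mul_le_mul_right _ (by omega)
      rcases Nat.eq_zero_or_pos J with h | h
      · subst h; simp at hlin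
      · omega
  let r : ℕ → F[X] := fun j => if h : j < J then (v.1 ⟨j, h⟩ : F[X]) else 0
  let s : ℕ → F[X] := fun j => if h : j < J then (v.2 ⟨j, h⟩ : F[X]) else 0
  have hr : ∀ j, (r j).degree < n := by
    intro j; simp only [r]; split_ifs
    · exact mem_degreeLT.1 (v.1 _).2
    · rw [degree_zero]; exact WithBot.bot_lt_coe _
  have hs : ∀ j, (s j).degree < n := by
    intro j; simp only [s]; split_ifs
    · exact mem_degreeLT.1 (v.2 _).2
    · rw [degree_zero]; exact WithBot.bot_lt_coe _
  set S : F[X] := ∑ j ∈ Finset.range J, (r j + s j * f ^ g) * ((X - C a0) ^ j) ^ q with hS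
  have hS0 : S ≠ 0 := by
    intro h0
    have := nonvanish f hodd H a0 ha0 n m hm hmq hn J r s hr hs h0
    apply hv0
    ext j : 2
    · have := (this j j.2).1
      simp only [r, j.2, dif_pos] at this
      exact Subtype.ext this
    · have := (this j j.2).2
      simp only [s, j.2, dif_pos] at this
      exact Subtype.ext this
  set R : F[X] := f ^ l * S with hR
  have hR0 : R ≠ 0 := mul_ne_zero (pow_ne_zero _ hf) hS0
  have hRdeg : R.natDegree ≤ l * m + n + m * g + J * q := by
    have h1 : (f ^ l).natDegree ≤ l * m := natDegree_pow_le.trans (Nat.mul_le_mul_left _ hm)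
    have h2 : S.natDegree ≤ n + m * g + J * q := by
      refine natDegree_sum_le_of_forall_le _ _ fun j hj => ?_
      have hj := Finset.mem_range.1 hj
      refine natDegree_mul_le.trans (add_le_add ?_ ?_)
      · refine (natDegree_add_le _ _).trans (max_le ?_ ?_)
        · exact (natDegree_le_of_degree_le (hr j).le).trans (by omega)
        · refine natDegree_mul_le.trans (add_le_add (natDegree_le_of_degree_le (hs j).le) ?_)
          rw [mul_comm m]
          exact natDegree_pow_le.trans (Nat.mul_le_mul_left _ hm)
      · rw [natDegree_pow, natDegree_pow, natDegree_X_sub_C, mul_one, mul_comm]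
        exact Nat.mul_le_mul_right _ hj.le
    refine natDegree_mul_le.trans ?_
    omega
  have hvan : ∀ x : F, (f.eval x) ^ g = a → ∀ k < l, (hasseDeriv k R).eval x = 0 := by
    intro x hx k hk
    have e1 : R = ∑ j : Fin J, ((v.1 j : F[X]) * f ^ l + (v.2 j : F[X]) * f ^ (l + g)) *
        ((X - C a0) ^ (j : ℕ)) ^ q := by
      rw [hR, hS, Finset.sum_range, Finset.mul_sum]
      refine Finset.sum_congr rfl fun j _ => ?_
      simp only [r, s, j.2, dif_pos, pow_add]
      ring
    have e2 := congrArg (eval x) (hQ0 ⟨k, hk⟩)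
    rw [hQ, eval_finsetSum, eval_zero] at e2
    rw [e1, map_sum, eval_finsetSum]
    rw [← zero_mul ((f.eval x) ^ (l - k)), ← e2, Finset.sum_mul]
    refine Finset.sum_congr rfl fun j _ => ?_
    rw [hasse_frob _ _ _ (by omega), map_add, (hU ⟨k, hk⟩ _).1, (hV ⟨k, hk⟩ _).1]
    have : l + g - k = g + (l - k) := by omega
    simp only [this, pow_add, eval_mul, eval_add, eval_pow, eval_sub, eval_X, eval_C, eval_smul,
      smul_eq_mul, hx]
    ring
  have hroot : ∀ x : F, (f.eval x) ^ g = a → l ≤ R.roots.count x := by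
    intro x hx
    rw [count_roots, le_rootMultiplicity_iff hR0]
    rw [X_sub_C_pow_dvd_iff]
    rw [← taylor_apply, X_pow_dvd_iff]
    intro k hk
    rw [taylor_coeff]; exact hvan x hx k hk
  calc l * (Finset.univ.filter fun x : F => (f.eval x) ^ g = a).card
      = ∑ x ∈ Finset.univ.filter (fun x : F => (f.eval x) ^ g = a), l := by
        rw [Finset.sum_const, smul_eq_mul, mul_comm]
    _ ≤ ∑ x ∈ Finset.univ.filter (fun x : F => (f.eval x) ^ g = a), R.roots.count x :=
        Finset.sum_le_sum fun x hx => hroot x (Finset.mem_filter.1 hx).2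
    _ ≤ ∑ x : F, R.roots.count x := Finset.sum_le_sum_of_subset (Finset.filter_subset _ _)
    _ = R.roots.card := Multiset.sum_count_eq_card (by simp)
    _ ≤ R.natDegree := card_roots' _
    _ ≤ _ := hRdeg

end Polynomial

open MvPolynomial

namespace Polynomial

theorem weil {F : Type*} [Field F] [Fintype F] [DecidableEq F] (f : F[X])
    (hodd : Odd (Fintype.card F))
    (H : ∀ (r s : F[X]) (c : F), c ≠ 0 → r ^ 2 * f = C c * s ^ 2 → r = 0)
    (m : ℕ) (hm1 : 1 ≤ m) (hm : f.natDegree ≤ m) :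
    |((∑ x : F, quadraticChar F (f.eval x) : ℤ) : ℝ)| ≤ 25 * m * √(Fintype.card F) := by
  set q := Fintype.card F with hq
  have hq1 : 1 < q := Fintype.one_lt_card
  have hf : f ≠ 0 := by
    rintro rfl
    have := H 1 0 1 one_ne_zero (by simp)
    exact one_ne_zero this
  have hsq : (√(q : ℝ)) ^ 2 = q := Real.sq_sqrt (by positivity)
  have hs0 : 0 ≤ √(q : ℝ) := Real.sqrt_nonneg _
  have hm1' : (1 : ℝ) ≤ m := by exact_mod_cast hm1
  have habs : ∀ y : F, |quadraticChar F y| ≤ 1 := by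
    intro y
    by_cases hy : y = 0
    · simp [hy]
    · rcases quadraticChar_dichotomy hy with h | h <;> simp [h]
  by_cases hbig : √(q : ℝ) ≤ 25 * m
  · have h1 : |(∑ x : F, quadraticChar F (f.eval x) : ℤ)| ≤ q := by
      refine (Finset.abs_sum_le_sum_abs _ _).trans ?_
      refine (Finset.sum_le_sum fun x _ => habs _).trans ?_
      simp [hq]
    have h2 : |((∑ x : F, quadraticChar F (f.eval x) : ℤ) : ℝ)| ≤ q := by exact_mod_cast h1
    nlinarith
  push Not at hbig
  have hmq : m < q := by
    have : (m : ℝ) < q := by nlinarith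
    exact_mod_cast this
  -- find a0
  obtain ⟨a0, ha0⟩ : ∃ a0 : F, f.eval a0 ≠ 0 := by
    by_contra! hc
    exact hf (eq_zero_of_natDegree_lt_card_of_eval_eq_zero f Function.injective_id
      (fun x => hc x) (by omega))
  set h := ⌊√(q : ℝ) / 2⌋₊ with hh
  have hh1 : (h : ℝ) ≤ √(q : ℝ) / 2 := Nat.floor_le (by positivity)
  have hh2 : √(q : ℝ) / 2 < h + 1 := Nat.lt_floor_add_one _
  set n := (q - m) / 2 with hn
  have hn1 : 2 * n + m ≤ q := by omega
  have hn2 : q ≤ 2 * n + m + 1 := by omega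
  have hn2' : (q : ℝ) ≤ 2 * n + m + 1 := by exact_mod_cast hn2
  have hl : 2 * h ≤ q := by
    have : (2 * h : ℝ) ≤ q := by nlinarith
    exact_mod_cast this
  have hlin : 2 * h * (n + 2 * h * m + (h + 2 * m + 2)) < 2 * ((h + 2 * m + 2) * n) := by
    have : (2 * h * (n + 2 * h * m + (h + 2 * m + 2)) : ℝ) < 2 * ((h + 2 * m + 2) * n) := by
      have h4 : (4 * h ^ 2 : ℝ) ≤ q := by nlinarith
      have h5 : (q : ℝ) / 2 ≤ 2 * n - 2 * h := by nlinarith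
      have h6 : (2 * m + 2) * ((q : ℝ) / 2) ≤ (2 * m + 2) * (2 * n - 2 * h) :=
        mul_le_mul_of_nonneg_left h5 (by positivity)
      have h7 : (4 * h ^ 2 : ℝ) * m ≤ q * m := mul_le_mul_of_nonneg_right h4 (by positivity)
      have : (0:ℝ) < q := by positivity
      nlinarith
    exact_mod_cast this
  have hcount := stepanov_count f hodd H a0 ha0 n m hm hmq hn1 (h + 2 * m + 2) (2 * h) hl hlin
  set g := (q - 1) / 2 with hg
  have hchar : ringChar F ≠ 2 := by
    intro h2
    have := FiniteField.even_card_iff_char_two.1 h2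
    obtain ⟨t, ht⟩ := hodd
    omega
  have hpow : ∀ y : F, (quadraticChar F y : F) = y ^ g := by
    intro y
    rw [quadraticChar_eq_pow_of_char_ne_two' hchar]
    congr 1
    obtain ⟨t, ht⟩ := hodd
    omega
  -- bound for each sign
  have hbound : ∀ a : F, ((Finset.univ.filter fun x : F => (f.eval x) ^ g = a).card : ℝ) ≤
      q / 2 + 12 * m * √(q : ℝ) := by
    intro a
    have h1 : ((2 * h * (Finset.univ.filter fun x : F => (f.eval x) ^ g = a).card : ℕ) : ℝ) ≤
      ((2 * h * m + n + m * g + (h + 2 * m + 2) * q : ℕ) : ℝ) := by exact_mod_cast hcount a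
    push_cast at h1
    have hg' : (g : ℝ) ≤ q / 2 := by
      have : 2 * g ≤ q := by omega
      have : (2 * g : ℝ) ≤ q := by exact_mod_cast this
      linarith
    have hn' : (n : ℝ) ≤ q / 2 := by
      have : 2 * n ≤ q := by omega
      have : (2 * n : ℝ) ≤ q := by exact_mod_cast this
      linarith
    have hh3 : √(q : ℝ) / 3 ≤ h := by linarith
    have hh0 : (0 : ℝ) < h := by nlinarith
    set N := ((Finset.univ.filter fun x : F => (f.eval x) ^ g = a).card : ℝ)
    have h2 : 2 * h * N ≤ 2 * h * (q / 2 + 12 * m * √(q : ℝ)) := by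
      have e1 : (m : ℝ) * g ≤ m * (q / 2) := mul_le_mul_of_nonneg_left hg' (by positivity)
      have e2 : √(q : ℝ) / 3 * (m * √(q : ℝ)) ≤ h * (m * √(q : ℝ)) :=
        mul_le_mul_of_nonneg_right hh3 (by positivity)
      have e3 : √(q : ℝ) / 3 * (m * √(q : ℝ)) = m * q / 3 := by
        linear_combination (m : ℝ) / 3 * hsq
      have e4 : (h : ℝ) * m ≤ h * (m * √(q : ℝ)) := by
        have : (1 : ℝ) ≤ √(q : ℝ) := by linarith
        have : (m : ℝ) ≤ m * √(q : ℝ) := by nlinarith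
        exact mul_le_mul_of_nonneg_left this hh0.le
      have e5 : (q : ℝ) ≤ m * q := by nlinarith [show (0 : ℝ) ≤ q by positivity]
      nlinarith
    exact le_of_mul_le_mul_left h2 (by positivity)
  have hz : ((Finset.univ.filter fun x : F => f.eval x = 0).card : ℝ) ≤ m := by
    have : (Finset.univ.filter fun x : F => f.eval x = 0).card ≤ m := by
      refine le_trans ?_ ((card_roots' f).trans hm)
      refine le_trans (Finset.card_le_card (t := f.roots.toFinset) ?_) (Multiset.toFinset_card_le _)
      intro x hx
      simpa [hf] using hx
    exact_mod_cast this
  have h1F : (1 : F) ≠ -1 := fun h => (Ring.neg_one_ne_one_of_char_ne_two hchar) h.symm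
  have hs : ∀ x, quadraticChar F (f.eval x) = (if (f.eval x) ^ g = 1 then 1 else 0) -
      (if (f.eval x) ^ g = -1 then 1 else 0) := by
    intro x
    rw [← hpow]
    by_cases hy : f.eval x = 0
    · simp [hy]
    · rcases quadraticChar_dichotomy hy with h | h <;> simp [h, h1F, h1F.symm]
  have hs2 : ∀ x, (1 : ℤ) = (if (f.eval x) ^ g = 1 then 1 else 0) +
      (if (f.eval x) ^ g = -1 then 1 else 0) + (if f.eval x = 0 then 1 else 0) := by
    intro x
    rw [← hpow]
    by_cases hy : f.eval x = 0
    · simp [hy]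
    · rcases quadraticChar_dichotomy hy with h | h <;> simp [h, h1F, h1F.symm, hy]
  have hA : (∑ x : F, quadraticChar F (f.eval x)) =
      ((Finset.univ.filter fun x : F => (f.eval x) ^ g = 1).card : ℤ) -
      (Finset.univ.filter fun x : F => (f.eval x) ^ g = -1).card := by
    rw [Finset.sum_congr rfl fun x _ => hs x, Finset.sum_sub_distrib]
    simp
  have hB : (q : ℤ) = ((Finset.univ.filter fun x : F => (f.eval x) ^ g = 1).card : ℤ) +
      (Finset.univ.filter fun x : F => (f.eval x) ^ g = -1).card +
      (Finset.univ.filter fun x : F => f.eval x = 0).card := by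
    have : (q : ℤ) = ∑ x : F, 1 := by simp [hq]
    rw [this, Finset.sum_congr rfl fun x _ => hs2 x, Finset.sum_add_distrib,
      Finset.sum_add_distrib]
    simp
  have hB' : (q : ℝ) = ((Finset.univ.filter fun x : F => (f.eval x) ^ g = 1).card : ℝ) +
      (Finset.univ.filter fun x : F => (f.eval x) ^ g = -1).card +
      (Finset.univ.filter fun x : F => f.eval x = 0).card := by exact_mod_cast hB
  have b1 := hbound 1
  have b2 := hbound (-1)
  have hms : (m : ℝ) ≤ m * √(q : ℝ) := by nlinarith
  rw [hA]; push_cast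
  rw [abs_le]; constructor <;> linarith

end Polynomial

open MvPolynomial

namespace Polynomial

theorem resultant_ne_zero_of_irred {R : Type*} [CommRing R] [IsDomain R]
    [UniqueFactorizationMonoid R] (p Q : R[X]) (hp : Irreducible p) (hd : p.natDegree ≠ 0)
    (h : ¬ p ∣ Q) : resultant p Q ≠ 0 := by
  let _ : NormalizedGCDMonoid R := Classical.arbitrary _
  let K := FractionRing R
  have hinj : Function.Injective (algebraMap R K) := IsFractionRing.injective R K
  have hpr := hp.isPrimitive hd
  have h1 : Irreducible (p.map (algebraMap R K)) :=
    hpr.irreducible_iff_irreducible_map_fraction_map.1 hp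
  have h2 : ¬ p.map (algebraMap R K) ∣ Q.map (algebraMap R K) := fun hh =>
    h ((hpr.dvd_iff_fraction_map_dvd_fraction_map K).2 hh)
  have h3 : IsCoprime (p.map (algebraMap R K)) (Q.map (algebraMap R K)) :=
    (h1.coprime_iff_not_dvd).2 h2
  intro h0
  have h4 := resultant_map_map p Q p.natDegree Q.natDegree (algebraMap R K)
  rw [h0, map_zero] at h4
  have h5 : resultant (p.map (algebraMap R K)) (Q.map (algebraMap R K)) = 0 := by
    rw [natDegree_map_eq_of_injective hinj, natDegree_map_eq_of_injective hinj]; exact h4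
  exact (resultant_eq_zero_iff.1 h5).2 h3

theorem parity_H {F : Type*} [Field F] (p G : F[X]) (hd : 0 < p.natDegree)
    (hc : IsCoprime p (derivative p * G)) (e : ℕ) (he : Odd e) :
    ∀ (r s : F[X]) (c : F), c ≠ 0 → r ^ 2 * (p ^ e * G) = C c * s ^ 2 → r = 0 := by
  intro r s c hc0 heq
  by_contra hr
  have hnu : ¬ IsUnit p := fun h => by
    have := natDegree_eq_zero_of_isUnit h; omega
  have hp0 : p ≠ 0 := by rintro rfl; simp at hd
  obtain ⟨π, hπ, a, rfl⟩ := WfDvdMonoid.exists_irreducible_factor hnu hp0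
  have hpr : Prime π := hπ.prime
  have hG : ¬ π ∣ derivative (π * a) * G := fun h =>
    hπ.not_isUnit (hc.isUnit_of_dvd' (dvd_mul_right _ _) h)
  have hG1 : ¬ π ∣ G := fun h => hG (h.mul_left _)
  have ha : ¬ π ∣ a := fun h => hG (by
    rw [derivative_mul]
    exact (dvd_add (h.mul_left _) (dvd_mul_right _ _)).mul_right _)
  have hA : ¬ π ∣ a ^ e * G := fun h => (hpr.dvd_or_dvd h).elim (fun h => ha (hpr.dvd_of_dvd_pow h)) hG1
  have hG0 : G ≠ 0 := by rintro rfl; simp at hG1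
  have hs : s ≠ 0 := by
    rintro rfl
    have : r ^ 2 * ((π * a) ^ e * G) ≠ 0 := mul_ne_zero (pow_ne_zero _ hr) (mul_ne_zero (pow_ne_zero _ hp0) hG0)
    apply this; rw [heq]; simp
  have e1 : r ^ 2 * ((π * a) ^ e * G) = π ^ e * (r ^ 2 * (a ^ e * G)) := by rw [mul_pow]; ring
  rw [e1] at heq
  generalize a ^ e * G = A at heq hA
  have fr : FiniteMultiplicity π r := FiniteMultiplicity.of_not_isUnit hπ.not_isUnit hr
  have fs : FiniteMultiplicity π s := FiniteMultiplicity.of_not_isUnit hπ.not_isUnit hs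
  have h1 := congrArg (emultiplicity π) heq
  rw [emultiplicity_mul hpr, emultiplicity_mul hpr, emultiplicity_mul hpr,
    emultiplicity_pow_self hπ.ne_zero hπ.not_isUnit, emultiplicity_pow hpr,
    emultiplicity_pow hpr, emultiplicity_eq_zero.2 hA,
    fr.emultiplicity_eq_multiplicity, fs.emultiplicity_eq_multiplicity,
    emultiplicity_eq_zero.2 (fun h => hπ.not_isUnit
      (isUnit_of_dvd_unit h (isUnit_C.2 hc0.isUnit)))] at h1
  have h2 : e + (2 * multiplicity π r + 0) = 0 + 2 * multiplicity π s := by exact_mod_cast h1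
  obtain ⟨t, ht⟩ := he
  omega

end Polynomial

namespace MvPolynomial

theorem totalDegree_det_le {σ F : Type*} [Field F] {N D : ℕ}
    (M : Matrix (Fin N) (Fin N) (MvPolynomial σ F)) (h : ∀ i j, (M i j).totalDegree ≤ D) :
    M.det.totalDegree ≤ N * D := by
  rw [Matrix.det_apply]
  refine totalDegree_finsetSum_le fun τ _ => ?_
  refine le_trans (b := (∏ i, M (τ i) i).totalDegree) ?_ ?_
  · rcases Int.units_eq_one_or (Equiv.Perm.sign τ) with h | h <;> simp [h]
  · refine (totalDegree_finsetProd _ _).trans ?_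
    refine (Finset.sum_le_sum fun i _ => h _ _).trans ?_
    simp

theorem totalDegree_resultant_le {σ F : Type*} [Field F] {D : ℕ}
    (p Q : Polynomial (MvPolynomial σ F)) (hp : p.natDegree ≤ D) (hQ : Q.natDegree ≤ D)
    (hp' : ∀ i, (p.coeff i).totalDegree ≤ D) (hQ' : ∀ i, (Q.coeff i).totalDegree ≤ D) :
    (Polynomial.resultant p Q).totalDegree ≤ 2 * D * D := by
  refine (totalDegree_det_le (D := D) _ ?_).trans (Nat.mul_le_mul_right _ (by omega))
  intro i j
  unfold Polynomial.sylvester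
  rw [Matrix.of_apply]
  refine Fin.addCases (fun j => ?_) (fun j => ?_) j
  · rw [Fin.addCases_left]; split_ifs
    · exact hQ' _
    · simp
  · rw [Fin.addCases_right]; split_ifs
    · exact hp' _
    · simp

theorem sz_count {F : Type*} [Field F] [Fintype F] [DecidableEq F] {n : ℕ}
    (r : MvPolynomial (Fin n) F) (hr : r ≠ 0) (D : ℕ) (hD : r.totalDegree ≤ D) :
    Fintype.card F * (Finset.univ.filter fun b : Fin n → F => eval b r = 0).card ≤
      D * Fintype.card F ^ n := by
  have h := schwartz_zippel_totalDegree hr (Finset.univ : Finset F)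
  have e : (Fintype.piFinset fun _ : Fin n => (Finset.univ : Finset F)) = Finset.univ := by
    ext; simp
  rw [e, Finset.card_univ] at h
  have hq : (0 : ℚ≥0) < Fintype.card F := by exact_mod_cast Fintype.card_pos
  rw [div_le_div_iff₀ (by positivity) hq] at h
  have h' : (Finset.univ.filter fun b : Fin n → F => eval b r = 0).card * Fintype.card F ≤
    r.totalDegree * Fintype.card F ^ n := by exact_mod_cast h
  calc _ = _ := mul_comm _ _
    _ ≤ _ := h'
    _ ≤ _ := Nat.mul_le_mul_right _ hD

end MvPolynomial

open MvPolynomial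

namespace MvPolynomial

theorem coeff_deg_le {F : Type*} [Field F] {n : ℕ} (P : MvPolynomial (Fin (n + 1)) F) (i : ℕ) :
    ((finSuccEquiv F n P).coeff i).totalDegree ≤ P.totalDegree := by
  by_cases h : (finSuccEquiv F n P).coeff i = 0
  · simp [h]
  · have := totalDegree_coeff_finSuccEquiv_add_le P i h; omega

theorem natDeg_le {F : Type*} [Field F] {n : ℕ} (P : MvPolynomial (Fin (n + 1)) F) :
    (finSuccEquiv F n P).natDegree ≤ P.totalDegree := by
  rw [natDegree_finSuccEquiv]; exact degreeOf_le_totalDegree _ _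

theorem charsum0 {F : Type*} [Field F] [Fintype F] [DecidableEq F]
    (hodd : Odd (Fintype.card F)) {n : ℕ} (P G : MvPolynomial (Fin (n + 1)) F)
    (hP : Irreducible P) (hPG : ¬ P ∣ G) (e : ℕ) (he : Odd e) (D : ℕ) (hD1 : 1 ≤ D)
    (hD : (P ^ e * G).totalDegree ≤ D)
    (hsep : Polynomial.derivative (finSuccEquiv F n P) ≠ 0) :
    |((∑ x : Fin (n + 1) → F, quadraticChar F (eval x (P ^ e * G)) : ℤ) : ℝ)| ≤
      25 * D * √(Fintype.card F) * (Fintype.card F : ℝ) ^ n +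
        3 * D ^ 2 * (Fintype.card F : ℝ) ^ n := by
  set q := Fintype.card F with hq
  have hP0 := hP.ne_zero
  have hG0 : G ≠ 0 := by rintro rfl; simp at hPG
  obtain ⟨e', rfl⟩ : ∃ e', e = e' + 1 := by obtain ⟨t, ht⟩ := he; exact ⟨2 * t, ht⟩
  have hPGD : P.totalDegree + G.totalDegree ≤ D := by
    rw [pow_succ, mul_assoc, totalDegree_mul_of_isDomain (pow_ne_zero _ hP0) (mul_ne_zero hP0 hG0),
      totalDegree_mul_of_isDomain hP0 hG0] at hD
    omega
  set p := finSuccEquiv F n P with hp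
  set γ := finSuccEquiv F n G with hγ
  have hpirr : Irreducible p := (MulEquiv.irreducible_iff (finSuccEquiv F n)).2 hP
  have hpγ : ¬ p ∣ γ := fun h => hPG ((map_dvd_iff (finSuccEquiv F n)).1 h)
  have hpd : p.natDegree ≠ 0 := fun h => hsep (Polynomial.derivative_of_natDegree_zero h)
  have hpder : ¬ p ∣ Polynomial.derivative p := fun h => by
    have h1 := Polynomial.natDegree_le_of_dvd h hsep
    have h2 := Polynomial.natDegree_derivative_lt hpd
    omega
  have hpQ : ¬ p ∣ Polynomial.derivative p * γ := fun h =>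
    (hpirr.prime.dvd_or_dvd h).elim hpder hpγ
  set Q := Polynomial.derivative p * γ with hQ
  have hres := Polynomial.resultant_ne_zero_of_irred p Q hpirr hpd hpQ
  have pdeg : p.natDegree ≤ P.totalDegree := natDeg_le P
  have γdeg : γ.natDegree ≤ G.totalDegree := natDeg_le G
  have hQdeg : Q.natDegree ≤ D := by
    refine Polynomial.natDegree_mul_le.trans ?_
    have := Polynomial.natDegree_derivative_le p
    omega
  have hQc : ∀ i, (Q.coeff i).totalDegree ≤ D := by
    intro i
    rw [hQ, Polynomial.coeff_mul]
    refine totalDegree_finsetSum_le fun ij _ => ?_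
    refine (totalDegree_mul _ _).trans (le_trans (add_le_add ?_ (coeff_deg_le G _)) hPGD)
    rw [Polynomial.coeff_derivative]
    refine (totalDegree_mul _ _).trans ?_
    have : ((ij.1 : MvPolynomial (Fin n) F) + 1).totalDegree = 0 := by
      have : ((ij.1 : MvPolynomial (Fin n) F) + 1) = C ((ij.1 : F) + 1) := by simp
      rw [this, totalDegree_C]
    rw [this]
    exact coeff_deg_le P _
  set R := p.leadingCoeff * Polynomial.resultant p Q with hR
  have hR0 : R ≠ 0 := mul_ne_zero (Polynomial.leadingCoeff_ne_zero.2 hpirr.ne_zero) hres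
  have hRD : R.totalDegree ≤ 3 * D ^ 2 := by
    refine (totalDegree_mul _ _).trans ?_
    have h1 := totalDegree_resultant_le (D := D) p Q (by omega) hQdeg
      (fun i => (coeff_deg_le P i).trans (by omega)) hQc
    have h2 : p.leadingCoeff.totalDegree ≤ D := (coeff_deg_le P _).trans (by omega)
    nlinarith
  have hbad := sz_count R hR0 _ hRD
  have habs : ∀ y : F, |quadraticChar F y| ≤ 1 := by
    intro y
    by_cases hy : y = 0
    · simp [hy]
    · rcases quadraticChar_dichotomy hy with h | h <;> simp [h]
  have hsum : (∑ x : Fin (n + 1) → F, quadraticChar F (eval x (P ^ (e' + 1) * G))) =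
      ∑ b : Fin n → F, ∑ y : F,
        quadraticChar F (((p.map (eval b)) ^ (e' + 1) * γ.map (eval b)).eval y) := by
    rw [← (Fin.consEquiv (fun _ : Fin (n + 1) => F)).sum_comp, Fintype.sum_prod_type,
      Finset.sum_comm]
    refine Finset.sum_congr rfl fun b _ => Finset.sum_congr rfl fun y _ => ?_
    congr 1
    have := eval_eq_eval_mv_eval' b y (P ^ (e' + 1) * G)
    rw [map_mul (finSuccEquiv F n), map_pow (finSuccEquiv F n), Polynomial.map_mul,
      Polynomial.map_pow] at this
    exact this
  have hgood : ∀ b : Fin n → F, eval b R ≠ 0 →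
      |((∑ y : F, quadraticChar F (((p.map (eval b)) ^ (e' + 1) * γ.map (eval b)).eval y) : ℤ) : ℝ)|
        ≤ 25 * D * √(q : ℝ) := by
    intro b hb
    rw [hR, map_mul] at hb
    have hl : eval b p.leadingCoeff ≠ 0 := left_ne_zero_of_mul hb
    have hr : eval b (Polynomial.resultant p Q) ≠ 0 := right_ne_zero_of_mul hb
    have hnd : (p.map (eval b)).natDegree = p.natDegree :=
      Polynomial.natDegree_map_of_leadingCoeff_ne_zero _ hl
    have hcop : IsCoprime (p.map (eval b)) (Polynomial.derivative (p.map (eval b)) * γ.map (eval b)) := by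
      obtain ⟨u, v, -, -, huv⟩ := Polynomial.exists_mul_add_mul_eq_C_resultant p Q le_rfl le_rfl
        (Or.inl hpd)
      have h2 := congrArg (Polynomial.map (eval b)) huv
      rw [Polynomial.map_add, Polynomial.map_mul, Polynomial.map_mul, Polynomial.map_C, hQ,
        Polynomial.map_mul, ← Polynomial.derivative_map] at h2
      have h3 : Polynomial.C (eval b (Polynomial.resultant p Q))⁻¹ *
          Polynomial.C (eval b (Polynomial.resultant p Q)) = 1 := by
        rw [← Polynomial.C_mul, inv_mul_cancel₀ hr, Polynomial.C_1]
      refine ⟨Polynomial.C (eval b (Polynomial.resultant p Q))⁻¹ * u.map (eval b),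
        Polynomial.C (eval b (Polynomial.resultant p Q))⁻¹ * v.map (eval b), ?_⟩
      rw [← h3, hQ, ← h2]; ring
    refine Polynomial.weil _ hodd (Polynomial.parity_H _ _ (by omega) hcop _ he) D hD1 ?_
    have := natDeg_le (P ^ (e' + 1) * G)
    rw [map_mul, map_pow] at this
    rw [← Polynomial.map_pow, ← Polynomial.map_mul]
    exact Polynomial.natDegree_map_le.trans (this.trans hD)
  have htriv : ∀ b : Fin n → F,
      |((∑ y : F, quadraticChar F (((p.map (eval b)) ^ (e' + 1) * γ.map (eval b)).eval y) : ℤ) : ℝ)|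
        ≤ q := by
    intro b
    have h1 : |(∑ y : F, quadraticChar F (((p.map (eval b)) ^ (e' + 1) * γ.map (eval b)).eval y) : ℤ)|
        ≤ q := by
      refine (Finset.abs_sum_le_sum_abs _ _).trans ?_
      refine (Finset.sum_le_sum fun x _ => habs _).trans ?_
      simp [hq]
    exact_mod_cast h1
  rw [hsum]
  push_cast
  refine (Finset.abs_sum_le_sum_abs _ _).trans ?_
  have hstep : ∀ b : Fin n → F,
      |∑ y : F, ((quadraticChar F (((p.map (eval b)) ^ (e' + 1) * γ.map (eval b)).eval y) : ℤ) : ℝ)|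
        ≤ 25 * D * √(q : ℝ) + (if eval b R = 0 then (q : ℝ) else 0) := by
    intro b
    by_cases hb : eval b R = 0
    · have := htriv b
      push_cast at this
      rw [if_pos hb]
      have : (0 : ℝ) ≤ 25 * D * √(q : ℝ) := by positivity
      linarith
    · have := hgood b hb
      push_cast at this
      rw [if_neg hb]; linarith
  refine (Finset.sum_le_sum fun b _ => hstep b).trans ?_
  rw [Finset.sum_add_distrib, ← Finset.sum_filter, Finset.sum_const, Finset.sum_const,
    Finset.card_univ, Fintype.card_fun, Fintype.card_fin, nsmul_eq_mul, nsmul_eq_mul]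
  have hb' : (q : ℝ) * (Finset.univ.filter fun b : Fin n → F => eval b R = 0).card ≤
    3 * D ^ 2 * (q : ℝ) ^ n := by exact_mod_cast hbad
  push_cast
  rw [← hq]
  nlinarith

theorem exists_sep {F σ : Type*} [Field F] [Fintype F] (p : ℕ) [Fact p.Prime] [CharP F p]
    (P : MvPolynomial σ F) (hP : Irreducible P) : ∃ j, ∃ s ∈ P.support, ¬ p ∣ s j := by
  by_contra! hc
  have hpp : p.Prime := Fact.out
  let Q0 : MvPolynomial σ F := ∑ s ∈ P.support,
    monomial (s.mapRange (fun a => a / p) (by simp)) ((frobeniusEquiv F p).symm (P.coeff s))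
  have : P = Q0 ^ p := by
    conv_lhs => rw [P.as_sum]
    simp only [Q0]
    rw [sum_pow_char]
    refine Finset.sum_congr rfl fun s hs => ?_
    rw [monomial_pow]
    have e1 : p • (s.mapRange (fun a => a / p) (by simp) : σ →₀ ℕ) = s := by
      refine Finsupp.ext fun j => ?_
      simp [Nat.mul_div_cancel' (hc j s hs)]
    have e2 : ((frobeniusEquiv F p).symm (P.coeff s)) ^ p = P.coeff s := by
      rw [← frobenius_def, ← frobeniusEquiv_apply]; simp
    rw [e1, e2]
  rw [this] at hP
  exact not_irreducible_pow hpp.ne_one hP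

theorem charsum {F : Type*} [Field F] [Fintype F] [DecidableEq F]
    (hodd : Odd (Fintype.card F)) {n : ℕ} (P G : MvPolynomial (Fin (n + 1)) F)
    (hP : Irreducible P) (hPG : ¬ P ∣ G) (e : ℕ) (he : Odd e) (D : ℕ) (hD1 : 1 ≤ D)
    (hD : (P ^ e * G).totalDegree ≤ D) :
    |((∑ x : Fin (n + 1) → F, quadraticChar F (eval x (P ^ e * G)) : ℤ) : ℝ)| ≤
      25 * D * √(Fintype.card F) * (Fintype.card F : ℝ) ^ n +
        3 * D ^ 2 * (Fintype.card F : ℝ) ^ n := by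
  obtain ⟨p, hp⟩ := CharP.exists F
  obtain ⟨t, hp', ht⟩ := FiniteField.card F p
  have := Fact.mk hp'
  obtain ⟨j, s, hs, hsj⟩ := exists_sep p P hP
  let τ : Equiv.Perm (Fin (n + 1)) := Equiv.swap 0 j
  let E := renameEquiv F τ
  have h1 := charsum0 hodd (E P) (E G) ((MulEquiv.irreducible_iff E).2 hP)
    (fun h => hPG ((map_dvd_iff E).1 h)) e he D hD1 (by
      rw [← map_pow, ← map_mul]
      exact (totalDegree_rename_le _ _).trans hD) (by
      intro h0
      have h2 := congrArg (fun z => (z.coeff (s j - 1)).coeff ((s.mapDomain τ).tail)) h0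
      have hsj0 : s j ≠ 0 := fun h => hsj (h ▸ dvd_zero _)
      simp only [Polynomial.coeff_derivative] at h2
      have e1 : s j - 1 + 1 = s j := by omega
      have e2 : (((s j - 1 : ℕ) : MvPolynomial (Fin n) F) + 1) = C ((s j : ℕ) : F) := by
        rw [← Nat.cast_succ, Nat.succ_eq_add_one, e1]; simp
      rw [e1, e2, mul_comm, coeff_C_mul, finSuccEquiv_coeff_coeff] at h2
      have e3 : Finsupp.cons (s j) (s.mapDomain τ).tail = s.mapDomain τ := by
        have : s j = s.mapDomain τ 0 := by
          rw [Finsupp.mapDomain_equiv_apply]; simp [τ]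
        rw [this, Finsupp.cons_tail]
      rw [e3, show E P = rename τ P from rfl, coeff_rename_mapDomain _ τ.injective] at h2
      simp only [Polynomial.coeff_zero, coeff_zero, mul_eq_zero] at h2
      rcases h2 with h2 | h2
      · exact hsj ((CharP.cast_eq_zero_iff F p _).1 h2)
      · exact (mem_support_iff.1 hs) h2)
  have hs : ∑ x : Fin (n + 1) → F, quadraticChar F (eval x (P ^ e * G)) =
      ∑ x : Fin (n + 1) → F, quadraticChar F (eval x (E P ^ e * E G)) := by
    rw [← (Equiv.arrowCongr τ (Equiv.refl F)).sum_comp]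
    refine Finset.sum_congr rfl fun x _ => ?_
    rw [← map_pow, ← map_mul, show E (P ^ e * G) = rename τ (P ^ e * G) from rfl, eval_rename]
    congr 3
  rw [hs]; exact h1

end MvPolynomial

open MvPolynomial

namespace MvPolynomial

theorem odd_factor {R : Type*} [CommRing R] [IsDomain R] [UniqueFactorizationMonoid R] (a : R) :
    (∃ u g : R, IsUnit u ∧ a = u * g ^ 2) ∨
      ∃ (P : R) (e : ℕ) (A : R), Irreducible P ∧ Odd e ∧ a = P ^ e * A ∧ ¬ P ∣ A := by
  induction a using UniqueFactorizationMonoid.induction_on_coprime with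
  | h0 => exact Or.inl ⟨1, 0, isUnit_one, by simp⟩
  | h1 h => exact Or.inl ⟨_, 1, h, by simp⟩
  | @hpr p i h =>
    rcases Nat.even_or_odd i with ⟨t, ht⟩ | hi
    · exact Or.inl ⟨1, p ^ t, isUnit_one, by rw [ht]; ring⟩
    · exact Or.inr ⟨p, i, 1, h.irreducible, hi, by simp, fun h' => h.not_isUnit (isUnit_of_dvd_one h')⟩
  | @hcp x y hxy hx hy =>
    rcases hx with ⟨u, g, hu, rfl⟩ | ⟨P, e, A, hP, he, rfl, hA⟩
    · rcases hy with ⟨u', g', hu', rfl⟩ | ⟨P, e, A, hP, he, rfl, hA⟩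
      · exact Or.inl ⟨u * u', g * g', hu.mul hu', by ring⟩
      · refine Or.inr ⟨P, e, (u * g ^ 2) * A, hP, he, by ring, fun h => ?_⟩
        rcases hP.prime.dvd_or_dvd h with h | h
        · exact hP.not_isUnit (hxy h (Dvd.dvd.mul_right (dvd_pow_self _ he.pos.ne') _))
        · exact hA h
    · refine Or.inr ⟨P, e, A * y, hP, he, by ring, fun h => ?_⟩
      rcases hP.prime.dvd_or_dvd h with h | h
      · exact hA h
      · exact hP.not_isUnit (hxy (Dvd.dvd.mul_right (dvd_pow_self _ he.pos.ne') _) h)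

theorem exists_zero {F : Type*} [Field F] {m : ℕ} (P : MvPolynomial (Fin m) F)
    (hP : ¬ IsUnit P) : ∃ v : Fin m → AlgebraicClosure F, aeval v P = 0 := by
  by_contra! h
  apply hP
  have h1 := vanishingIdeal_zeroLocus_eq_radical (K := AlgebraicClosure F) (Ideal.span {P})
  have h2 : zeroLocus (AlgebraicClosure F) (Ideal.span {P}) = ∅ := by
    rw [Set.eq_empty_iff_forall_notMem]
    intro v hv
    exact h v (hv P (Ideal.mem_span_singleton_self P))
  rw [h2] at h1
  have h3 : (Ideal.span {P}).radical = ⊤ := by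
    rw [← h1]; exact vanishingIdeal_empty
  rw [Ideal.radical_eq_top, Ideal.span_singleton_eq_top] at h3
  exact h3

theorem adm_subst {F : Type*} [Field F] {k : ℕ} (f : MvPolynomial (Fin k) F)
    (hf : f.IsSymmetric) (ha : Admissible f) (j : Fin k) (v : Fin k → AlgebraicClosure F) :
    aeval (fun i => if i = j then (Polynomial.X : Polynomial (AlgebraicClosure F))
      else Polynomial.C (v i)) f ≠ 0 := by
  have hk : 0 < k := j.pos
  let z : Fin k := ⟨0, hk⟩
  intro h0
  rw [← hf (Equiv.swap z j), aeval_rename] at h0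
  apply ha.2 (fun i => v (Equiv.swap z j ⟨i + 1, by omega⟩))
  rw [substX, aeval_def, eval₂_map]
  rw [aeval_def] at h0
  refine Eq.trans ?_ h0
  congr 1
  funext i
  by_cases hi : (i : ℕ) = 0
  · have : i = z := Fin.ext hi
    simp [this, z]
  · have hne : i ≠ z := fun h => hi (congrArg Fin.val h)
    have h1 : Equiv.swap z j i ≠ j := fun h => hne (by
      rw [← Equiv.swap_apply_left z j] at h
      exact (Equiv.swap z j).injective h)
    have h2 : (⟨(i : ℕ) - 1 + 1, by omega⟩ : Fin k) = i := Fin.ext (by simp; omega)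
    simp [hi, h1, h2]

theorem factor_vars {F : Type*} [Field F] {k m : ℕ} (f : MvPolynomial (Fin k) F)
    (hf : f.IsSymmetric) (ha : Admissible f) (e : Fin k → Fin m) (he : Function.Injective e)
    (P : MvPolynomial (Fin m) F) (hP : Irreducible P) (hd : P ∣ rename e f) (j : Fin k) :
    e j ∈ P.vars := by
  by_contra hj
  obtain ⟨v, hv⟩ := exists_zero P hP.not_isUnit
  obtain ⟨Q, hQ⟩ := hd
  have h1 : aeval (fun i => if i = e j then (Polynomial.X : Polynomial (AlgebraicClosure F))
      else Polynomial.C (v i)) P = 0 := by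
    have : aeval (fun i => if i = e j then (Polynomial.X : Polynomial (AlgebraicClosure F))
      else Polynomial.C (v i)) P = aeval (fun i => Polynomial.C (v i)) P := by
      refine eval₂Hom_congr' rfl (fun i hi _ => ?_) rfl
      rw [if_neg]
      rintro rfl
      exact hj hi
    rw [this]
    have h2 := aeval_algebraMap_apply (R := F) (Polynomial (AlgebraicClosure F)) v P
    rw [hv, map_zero] at h2
    exact h2
  have h2 := congrArg (aeval (fun i => if i = e j then (Polynomial.X : Polynomial (AlgebraicClosure F))
      else Polynomial.C (v i))) hQ
  rw [map_mul, h1, zero_mul, aeval_rename] at h2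
  refine adm_subst f hf ha j (v ∘ e) ?_
  rw [← h2]
  congr 2
  funext i
  simp [he.eq_iff]

theorem vars_of_dvd {F σ : Type*} [Field F] (P Q : MvPolynomial σ F) (hQ : Q ≠ 0) (h : P ∣ Q)
    (j : σ) (hj : j ∈ P.vars) : j ∈ Q.vars := by
  classical
  obtain ⟨R, rfl⟩ := h
  have h0 := degreeOf_mul_eq (n := j) (left_ne_zero_of_mul hQ) (right_ne_zero_of_mul hQ)
  have key : ∀ p : MvPolynomial σ F, j ∈ p.vars ↔ degreeOf j p ≠ 0 := by
    intro p
    rw [vars_def, Multiset.mem_toFinset, degreeOf_def, Ne, Multiset.count_eq_zero, not_not]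
  rw [key] at hj ⊢
  omega

/-- combined: product over nonempty family -/
theorem charsum_prod {F : Type*} [Field F] [Fintype F] [DecidableEq F]
    (hodd : Odd (Fintype.card F)) {k n : ℕ} (f : MvPolynomial (Fin k) F)
    (hf : f.IsSymmetric) (ha : Admissible f) {ι : Type*} (T : Finset ι)
    (E : ι → Fin k → Fin (n + 1)) (hE : ∀ s, Function.Injective (E s))
    (hr : ∀ s ∈ T, ∀ t ∈ T, s ≠ t → ∃ j, E s j ∉ Set.range (E t))
    (hT : T.Nonempty) (D : ℕ) (hD1 : 1 ≤ D) (hD : T.card * f.totalDegree ≤ D) :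
    |((∑ x : Fin (n + 1) → F, ∏ s ∈ T, quadraticChar F (eval (x ∘ E s) f) : ℤ) : ℝ)| ≤
      25 * D * √(Fintype.card F) * (Fintype.card F : ℝ) ^ n +
        3 * D ^ 2 * (Fintype.card F : ℝ) ^ n := by
  classical
  have hf0 : f ≠ 0 := fun h => ha.1 ⟨0, 0, by simp [h]⟩
  have hren0 : ∀ s, rename (E s) f ≠ 0 := fun s h => hf0 (rename_injective _ (hE s) (by simpa using h))
  obtain ⟨s, hs⟩ := hT
  rcases odd_factor (rename (E s) f) with ⟨u, g, hu, hug⟩ | ⟨P, e, A, hP, he, hA, hPA⟩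
  · exfalso
    obtain ⟨c, -, rfl⟩ := isUnit_iff_eq_C_of_isReduced.1 hu
    refine ha.1 ⟨c, killCompl (hE s) g, ?_⟩
    have := congrArg (killCompl (hE s)) hug
    rw [killCompl_rename_app, map_mul, map_pow] at this
    rw [this]
    congr 1
    exact AlgHom.commutes (killCompl (hE s)) c
  · have hprod : ∏ t ∈ T, rename (E t) f = P ^ e * (A * ∏ t ∈ T.erase s, rename (E t) f) := by
      rw [← Finset.mul_prod_erase T _ hs, hA]; ring
    have hPG : ¬ P ∣ A * ∏ t ∈ T.erase s, rename (E t) f := by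
      intro h
      rcases hP.prime.dvd_or_dvd h with h | h
      · exact hPA h
      · obtain ⟨t, ht, h⟩ := hP.prime.exists_mem_finset_dvd h
        obtain ⟨hts, htT⟩ := Finset.mem_erase.1 ht
        obtain ⟨j, hj⟩ := hr s hs t htT hts.symm
        have h1 := factor_vars f hf ha (E s) (hE s) P hP
          (hA ▸ Dvd.dvd.mul_right (dvd_pow_self _ he.pos.ne') _) j
        have h2 := vars_rename (E t) f (vars_of_dvd P _ (hren0 t) h _ h1)
        obtain ⟨i, -, hi⟩ := Finset.mem_image.1 h2
        exact hj ⟨i, hi⟩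
    have hmain := charsum hodd P _ hP hPG e he D hD1 (by
      rw [← hprod]
      refine (totalDegree_finsetProd _ _).trans (le_trans ?_ hD)
      refine (Finset.sum_le_sum fun t _ => totalDegree_rename_le (E t) f).trans ?_
      simp)
    rw [← hprod] at hmain
    refine le_trans (le_of_eq ?_) hmain
    congr 2
    refine Finset.sum_congr rfl fun x _ => ?_
    rw [map_prod, map_prod]
    refine Finset.prod_congr rfl fun t _ => ?_
    rw [eval_rename]

end MvPolynomial

open MvPolynomial

namespace MvPolynomial

abbrev KSub (k m : ℕ) := {S : Finset (Fin m) // S.card = k}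

noncomputable def subE {k m : ℕ} (S : KSub k m) : Fin k → Fin m := S.1.orderEmbOfFin S.2

theorem subE_inj {k m : ℕ} (S : KSub k m) : Function.Injective (subE S) :=
  (S.1.orderEmbOfFin S.2).injective

theorem range_subE {k m : ℕ} (S : KSub k m) : Set.range (subE S) = S.1 :=
  Finset.range_orderEmbOfFin S.1 S.2

theorem subE_sep {k m : ℕ} (S T : KSub k m) (h : S ≠ T) : ∃ j, subE S j ∉ Set.range (subE T) := by
  by_contra! hc
  apply h
  apply Subtype.ext
  apply Finset.eq_of_subset_of_card_le
  · intro i hi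
    have : i ∈ Set.range (subE S) := by rw [range_subE]; exact hi
    obtain ⟨j, rfl⟩ := this
    have := hc j
    rw [range_subE] at this
    exact this
  · rw [S.2, T.2]

theorem dioph_iff {F : Type*} [Field F] [DecidableEq F] {k m : ℕ} (f : MvPolynomial (Fin k) F)
    (hf : f.IsSymmetric) (x : Fin m → F) (hx : Function.Injective x) :
    IsfDiophantine f (Finset.univ.image x) ↔ ∀ S : KSub k m, IsSquare (eval (x ∘ subE S) f) := by
  constructor
  · intro h S
    exact h _ (hx.comp (subE_inj S)) (fun i => by simp)
  · intro h a ha hmem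
    have : ∀ i, ∃ y, x y = a i := by
      intro i
      simpa using hmem i
    choose y hy using this
    have hyi : Function.Injective y := fun i j hij => ha (by rw [← hy, ← hy, hij])
    let S : KSub k m := ⟨Finset.univ.image y, by rw [Finset.card_image_of_injective _ hyi]; simp⟩
    have h1 : ∀ i, ∃ t, subE S t = y i := by
      intro i
      have : y i ∈ Set.range (subE S) := by rw [range_subE]; simp [S]
      exact this
    choose t ht using h1
    have hti : Function.Injective t := fun i j hij => hyi (by rw [← ht, ← ht, hij])
    let τ : Equiv.Perm (Fin k) := Equiv.ofBijective t (Finite.injective_iff_bijective.1 hti)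
    have h2 := h S
    rw [← hf τ, eval_rename] at h2
    convert h2 using 2
    congr 1
    funext i
    simp [τ, ht, hy]

theorem card_fiber {F : Type*} [Fintype F] [DecidableEq F] {m : ℕ} (A : Finset F)
    (hA : A.card = m) :
    (Finset.univ.filter fun x : Fin m → F => Finset.univ.image x = A).card = m.factorial := by
  have h1 : Fintype.card (Fin m ↪ A) = m.factorial := by
    rw [Fintype.card_embedding_eq]
    simp [hA, Nat.descFactorial_self]
  rw [← h1, ← Finset.card_univ]
  symm
  refine Finset.card_bij (fun φ _ i => (φ i : F)) ?_ ?_ ?_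
  · intro φ _
    rw [Finset.mem_filter]
    refine ⟨Finset.mem_univ _, ?_⟩
    apply Finset.eq_of_subset_of_card_le
    · intro a ha
      obtain ⟨i, -, rfl⟩ := Finset.mem_image.1 ha
      exact (φ i).2
    · rw [Finset.card_image_of_injective _ (fun i j h => φ.injective (Subtype.ext h))]
      simp [hA]
  · intro φ _ ψ _ h
    ext i
    exact congrFun h i
  · intro x hx
    rw [Finset.mem_filter] at hx
    have hinj : Function.Injective x := by
      have : (Finset.univ.image x).card = (Finset.univ : Finset (Fin m)).card := by
        rw [hx.2, hA]; simp
      have := Finset.card_image_iff.1 this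
      simpa using this
    refine ⟨⟨fun i => ⟨x i, ?_⟩, fun i j h => hinj (congrArg Subtype.val h)⟩, Finset.mem_univ _, rfl⟩
    rw [← hx.2]; simp

theorem count_eq {F : Type*} [Field F] [Fintype F] [DecidableEq F] {k m : ℕ}
    (f : MvPolynomial (Fin k) F) (hf : f.IsSymmetric) :
    Nat.card {x : Fin m → F // Function.Injective x ∧ ∀ S : KSub k m, IsSquare (eval (x ∘ subE S) f)} =
      Set.ncard {A : Finset F | A.card = m ∧ IsfDiophantine f A} * m.factorial := by
  classical
  rw [Nat.card_eq_fintype_card, Fintype.card_subtype, Set.ncard_eq_toFinset_card',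
    Set.toFinset_setOf]
  rw [Finset.card_eq_sum_card_fiberwise (f := fun x : Fin m → F => Finset.univ.image x)
    (t := Finset.univ.filter fun A : Finset F => A.card = m ∧ IsfDiophantine f A)]
  · rw [Finset.sum_const_nat]
    intro A hA
    rw [Finset.mem_filter] at hA
    rw [← card_fiber A hA.2.1]
    congr 1
    ext x
    simp only [Finset.mem_filter, Finset.mem_univ, true_and, and_iff_right_iff_imp]
    intro hx
    have hinj : Function.Injective x := by
      have : (Finset.univ.image x).card = (Finset.univ : Finset (Fin m)).card := by
        rw [hx, hA.2.1]; simp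
      have := Finset.card_image_iff.1 this
      simpa using this
    refine ⟨hinj, (dioph_iff f hf x hinj).1 ?_⟩
    rw [hx]; exact hA.2.2
  · intro x hx
    simp only [Finset.coe_filter, Finset.mem_univ, true_and, Set.mem_setOf_eq] at hx ⊢
    refine ⟨?_, (dioph_iff f hf x hx.1).2 hx.2⟩
    rw [Finset.card_image_of_injective _ hx.1]; simp

theorem main_count {F : Type*} [Field F] [Fintype F] [DecidableEq F]
    (hodd : Odd (Fintype.card F)) {k n : ℕ} (hk : k ≤ n + 1) (f : MvPolynomial (Fin k) F)
    (hf : f.IsSymmetric) (ha : Admissible f) (d B : ℕ) (hd1 : 1 ≤ d) (hd : f.totalDegree = d)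
    (hB : (n + 1).choose k = B) :
    |(Nat.card {x : Fin (n + 1) → F // Function.Injective x ∧
        ∀ S : KSub k (n + 1), IsSquare (eval (x ∘ subE S) f)} : ℝ) -
        (Fintype.card F : ℝ) ^ (n + 1) / 2 ^ B| ≤
      25 * (B * d) * √(Fintype.card F) * (Fintype.card F : ℝ) ^ n +
        3 * (B * d) ^ 2 * (Fintype.card F : ℝ) ^ n +
        ((n + 1) ^ 2 + B * d) * (Fintype.card F : ℝ) ^ n := by
  classical
  have hB1 : 1 ≤ B := hB ▸ Nat.choose_pos hk
  have hcard : Fintype.card (KSub k (n + 1)) = B := by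
    rw [← hB]; simp
  have hf0 : f ≠ 0 := fun h => ha.1 ⟨0, 0, by simp [h]⟩
  have hchar : ringChar F ≠ 2 := by
    intro h
    have := FiniteField.even_card_of_char_two h
    rw [Nat.odd_iff] at hodd
    omega
  set q := Fintype.card F with hq
  have hq0 : 0 < q := Fintype.card_pos
  set K : ℝ := 25 * (B * d) * √q * (q : ℝ) ^ n + 3 * (B * d) ^ 2 * (q : ℝ) ^ n with hK
  have hK0 : 0 ≤ K := by positivity
  let W : (Fin (n + 1) → F) → ℤ := fun x =>
    ∏ S : KSub k (n + 1), (1 + quadraticChar F (eval (x ∘ subE S) f))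
  -- sum of W
  have hW : |((∑ x, W x : ℤ) : ℝ) - (q : ℝ) ^ (n + 1)| ≤ 2 ^ B * K := by
    have h1 : (∑ x, W x) = ∑ T : Finset (KSub k (n + 1)),
        ∑ x : Fin (n + 1) → F, ∏ S ∈ T, quadraticChar F (eval (x ∘ subE S) f) := by
      rw [Finset.sum_comm]
      refine Finset.sum_congr rfl fun x _ => ?_
      simp only [W]
      rw [Finset.prod_one_add, Finset.powerset_univ]
    rw [h1, ← Finset.add_sum_erase _ _ (Finset.mem_univ ∅)]
    have h2 : (∑ x : Fin (n + 1) → F, ∏ S ∈ (∅ : Finset (KSub k (n + 1))),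
        quadraticChar F (eval (x ∘ subE S) f)) = (q : ℤ) ^ (n + 1) := by simp [hq]
    rw [h2]
    have h3 : ∀ T ∈ (Finset.univ : Finset (Finset (KSub k (n + 1)))).erase ∅,
        |((∑ x : Fin (n + 1) → F, ∏ S ∈ T, quadraticChar F (eval (x ∘ subE S) f) : ℤ) : ℝ)| ≤ K := by
      intro T hT
      have := charsum_prod hodd f hf ha T subE subE_inj (fun s _ t _ h => subE_sep s t h)
        (Finset.nonempty_iff_ne_empty.2 (Finset.ne_of_mem_erase hT)) (B * d)
        (Nat.mul_pos hB1 hd1) (by rw [hd, ← hcard]; exact Nat.mul_le_mul_right _ T.card_le_univ)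
      rw [hK]
      exact_mod_cast this
    rw [Int.cast_add, Int.cast_sum]
    have h4 : (((q : ℤ) ^ (n + 1) : ℤ) : ℝ) = (q : ℝ) ^ (n + 1) := by push_cast; rfl
    rw [h4, add_sub_cancel_left]
    refine (Finset.abs_sum_le_sum_abs _ _).trans ((Finset.sum_le_sum h3).trans ?_)
    rw [Finset.sum_const, nsmul_eq_mul]
    refine mul_le_mul_of_nonneg_right ?_ hK0
    have : ((Finset.univ : Finset (Finset (KSub k (n + 1)))).erase ∅).card ≤ 2 ^ B := by
      refine (Finset.card_erase_le).trans ?_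
      rw [Finset.card_univ, Fintype.card_finset, hcard]
    exact_mod_cast this
  -- bad locus
  let r : MvPolynomial (Fin (n + 1)) F :=
    (∏ p ∈ (Finset.univ : Finset (Fin (n + 1))).offDiag, (X p.1 - X p.2)) *
      ∏ S : KSub k (n + 1), rename (subE S) f
  have hr0 : r ≠ 0 := by
    refine mul_ne_zero (Finset.prod_ne_zero_iff.2 fun p hp => ?_)
      (Finset.prod_ne_zero_iff.2 fun S _ => ?_)
    · rw [sub_ne_zero]
      intro h
      exact (Finset.mem_offDiag.1 hp).2.2 (X_injective h)
    · intro h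
      exact hf0 (rename_injective _ (subE_inj S) (by simpa using h))
  have hrD : r.totalDegree ≤ (n + 1) ^ 2 + B * d := by
    refine (totalDegree_mul _ _).trans (add_le_add ?_ ?_)
    · refine (totalDegree_finsetProd _ _).trans ?_
      refine (Finset.sum_le_sum (g := fun _ => 1) fun p _ => ?_).trans ?_
      · refine (totalDegree_sub _ _).trans ?_
        simp
      · simp only [Finset.sum_const, Finset.offDiag_card, Finset.card_univ, Fintype.card_fin,
          smul_eq_mul, mul_one]
        rw [sq]; exact Nat.sub_le _ _
    · refine (totalDegree_finsetProd _ _).trans ?_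
      refine (Finset.sum_le_sum (g := fun _ => d) fun S _ => ?_).trans ?_
      · exact hd ▸ totalDegree_rename_le _ _
      · simp only [Finset.sum_const, Finset.card_univ, hcard, smul_eq_mul, le_refl]
  have hbad := sz_count r hr0 _ hrD
  set bad := Finset.univ.filter fun x : Fin (n + 1) → F => eval x r = 0 with hbaddef
  have hbad' : (bad.card : ℝ) ≤ ((n + 1) ^ 2 + B * d) * (q : ℝ) ^ n := by
    have h1 : bad.card ≤ ((n + 1) ^ 2 + B * d) * q ^ n := by
      rw [← hq, pow_succ] at hbad
      apply Nat.le_of_mul_le_mul_left _ hq0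
      calc _ ≤ _ := hbad
        _ = _ := by ring
    exact_mod_cast h1
  have hχ : ∀ y : F, 0 ≤ 1 + quadraticChar F y ∧ 1 + quadraticChar F y ≤ 2 := by
    intro y
    by_cases hy : y = 0
    · simp [hy]
    · rcases quadraticChar_dichotomy hy with h | h <;> simp [h]
  let I : (Fin (n + 1) → F) → ℤ := fun x =>
    if Function.Injective x ∧ ∀ S : KSub k (n + 1), IsSquare (eval (x ∘ subE S) f) then 1 else 0
  have hWI : ∀ x, |2 ^ B * I x - W x| ≤ if eval x r = 0 then 2 ^ B else 0 := by
    intro x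
    by_cases hx : eval x r = 0
    · rw [if_pos hx]
      have w0 : 0 ≤ W x := Finset.prod_nonneg fun S _ => (hχ _).1
      have w1 : W x ≤ 2 ^ B := by
        calc W x ≤ ∏ S : KSub k (n + 1), (2 : ℤ) :=
              Finset.prod_le_prod (fun S _ => (hχ _).1) (fun S _ => (hχ _).2)
          _ = 2 ^ B := by rw [Finset.prod_const, Finset.card_univ, hcard]
      have hp : (0 : ℤ) < 2 ^ B := by positivity
      simp only [I]
      split_ifs
      · rw [abs_le]; constructor <;> linarith
      · rw [abs_le]; constructor <;> linarith
    · rw [if_neg hx]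
      simp only [r, map_mul, map_prod, map_sub, eval_X, eval_rename] at hx
      have hx1 := Finset.prod_ne_zero_iff.1 (left_ne_zero_of_mul hx)
      have hx2 := Finset.prod_ne_zero_iff.1 (right_ne_zero_of_mul hx)
      have hinj : Function.Injective x := by
        intro i j hij
        by_contra hne
        exact hx1 (i, j) (by simp [hne]) (by simp [hij])
      suffices 2 ^ B * I x = W x by simp [this]
      by_cases hS : ∀ S : KSub k (n + 1), IsSquare (eval (x ∘ subE S) f)
      · simp only [I, W]
        rw [if_pos ⟨hinj, hS⟩]
        rw [Finset.prod_congr rfl (g := fun _ => (2 : ℤ)), Finset.prod_const, Finset.card_univ,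
          hcard, mul_one]
        intro S _
        rw [(quadraticChar_one_iff_isSquare (hx2 S (Finset.mem_univ _))).2 (hS S)]
        norm_num
      · simp only [I, W]
        rw [if_neg (fun h => hS h.2)]
        push Not at hS
        obtain ⟨S, hS⟩ := hS
        rw [Finset.prod_eq_zero (Finset.mem_univ S), mul_zero]
        rw [quadraticChar_neg_one_iff_not_isSquare.2 hS]
        norm_num
  have hN : (Nat.card {x : Fin (n + 1) → F // Function.Injective x ∧
        ∀ S : KSub k (n + 1), IsSquare (eval (x ∘ subE S) f)} : ℝ) = ((∑ x, I x : ℤ) : ℝ) := by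
    rw [Nat.card_eq_fintype_card, Fintype.card_subtype]
    simp [I]
  rw [hN]
  have hdiff : |(2 : ℝ) ^ B * ((∑ x, I x : ℤ) : ℝ) - ((∑ x, W x : ℤ) : ℝ)| ≤ 2 ^ B * bad.card := by
    have : |2 ^ B * (∑ x, I x) - ∑ x, W x| ≤ 2 ^ B * (bad.card : ℤ) := by
      rw [Finset.mul_sum, ← Finset.sum_sub_distrib]
      refine (Finset.abs_sum_le_sum_abs _ _).trans ((Finset.sum_le_sum fun x _ => hWI x).trans ?_)
      rw [← Finset.sum_filter, Finset.sum_const, nsmul_eq_mul, mul_comm]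
    exact_mod_cast this
  have hp : (0 : ℝ) < 2 ^ B := by positivity
  have h5 : |(2 : ℝ) ^ B * (((∑ x, I x : ℤ) : ℝ) - (q : ℝ) ^ (n + 1) / 2 ^ B)| ≤
      2 ^ B * (K + ((n + 1) ^ 2 + B * d) * (q : ℝ) ^ n) := by
    have e : (2 : ℝ) ^ B * (((∑ x, I x : ℤ) : ℝ) - (q : ℝ) ^ (n + 1) / 2 ^ B) =
        ((2 : ℝ) ^ B * ((∑ x, I x : ℤ) : ℝ) - ((∑ x, W x : ℤ) : ℝ)) +
          (((∑ x, W x : ℤ) : ℝ) - (q : ℝ) ^ (n + 1)) := by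
      field_simp; ring
    rw [e]
    refine (abs_add_le _ _).trans ?_
    have := mul_le_mul_of_nonneg_left hbad' hp.le
    linarith
  rw [abs_mul, abs_of_pos hp] at h5
  exact le_of_mul_le_mul_left h5 hp

end MvPolynomial

open MvPolynomial

theorem sq_le_two_fact (n : ℕ) : (n + 1) ^ 2 ≤ 2 * (n + 1).factorial := by
  induction n with
  | zero => simp
  | succ n ih =>
    rw [Nat.factorial_succ]
    rcases n with _ | n
    · simp
    · have : n + 1 + 1 + 1 ≤ (n + 1 + 1) ^ 2 := by nlinarith
      calc (n + 1 + 1 + 1) ^ 2 = (n + 1 + 1 + 1) * (n + 1 + 1 + 1) := sq _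
        _ ≤ (n + 1 + 1 + 1) * (n + 1 + 1) ^ 2 := Nat.mul_le_mul_left _ this
        _ ≤ (n + 1 + 1 + 1) * (2 * (n + 1 + 1).factorial) := Nat.mul_le_mul_left _ ih
        _ = _ := by ring

theorem stmt_4 (k : ℕ) (hk : 2 ≤ k) :
    ∃ C : ℝ, 0 < C ∧
      ∀ (q : ℕ) (F : Type) [Field F] [Fintype F],
        Fintype.card F = q → Odd q →
        ∀ d : ℕ, 1 ≤ d →
        ∀ f : MvPolynomial (Fin k) F, f.IsSymmetric → f.totalDegree = d → Admissible f →
        ∀ m : ℕ, k ≤ m →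
          |(Set.ncard {A : Finset F | A.card = m ∧ IsfDiophantine f A} : ℝ) -
              (q : ℝ) ^ m / ((m.factorial : ℝ) * 2 ^ (m.choose k))| ≤
            C * (((2 * d : ℕ) : ℝ) ^ (2 * m.choose k) * (q : ℝ) ^ ((m : ℝ) - 1 / 2) +
              ((2 * d : ℕ) : ℝ) ^ ((13 * (m.choose k) : ℝ) / 3) * (q : ℝ) ^ (m - 1)) := by
  refine ⟨25, by norm_num, ?_⟩
  intro q F _ _ hq hodd d hd1 f hf hd ha m hm
  classical
  obtain ⟨n, rfl⟩ : ∃ n, m = n + 1 := ⟨m - 1, by omega⟩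
  subst hq
  set q := Fintype.card F with hqdef
  have hq0 : 0 < q := Fintype.card_pos
  have hmain := main_count hodd hm f hf ha d _ hd1 hd rfl
  have hB1 : 1 ≤ (n + 1).choose k := Nat.choose_pos hm
  rw [count_eq f hf, ← hqdef] at hmain
  set B := (n + 1).choose k with hB
  set c := Set.ncard {A : Finset F | A.card = n + 1 ∧ IsfDiophantine f A} with hc
  have hfact : (0 : ℝ) < ((n + 1).factorial : ℝ) := by exact_mod_cast Nat.factorial_pos _
  have hfact1 : (1 : ℝ) ≤ ((n + 1).factorial : ℝ) := by exact_mod_cast Nat.factorial_pos _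
  have hrp : (q : ℝ) ^ (((n + 1 : ℕ) : ℝ) - 1 / 2) = √q * (q : ℝ) ^ n := by
    have : (((n + 1 : ℕ) : ℝ) - 1 / 2) = 1 / 2 + (n : ℝ) := by push_cast; ring
    rw [this, Real.rpow_add (by exact_mod_cast hq0), Real.rpow_natCast, Real.sqrt_eq_rpow]
  rw [hrp, Nat.add_sub_cancel]
  have hd1' : (1 : ℝ) ≤ d := by exact_mod_cast hd1
  set Y : ℝ := ((2 * d : ℕ) : ℝ) ^ (2 * B) with hY
  have hYle : Y ≤ ((2 * d : ℕ) : ℝ) ^ ((13 * (B : ℝ)) / 3) := by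
    rw [hY, ← Real.rpow_natCast]
    apply Real.rpow_le_rpow_of_exponent_le
    · push_cast; linarith
    · push_cast
      have : (0 : ℝ) ≤ B := by positivity
      linarith
  have hY1 : ((B : ℝ) * d) ^ 2 ≤ Y := by
    rw [hY, mul_comm 2 B, pow_mul, ]
    have h1 : B * d ≤ (2 * d) ^ B := by
      rw [mul_pow]
      exact Nat.mul_le_mul Nat.lt_two_pow_self.le (Nat.le_self_pow (by omega) d)
    have h2 : (B : ℝ) * d ≤ ((2 * d : ℕ) : ℝ) ^ B := by exact_mod_cast h1
    exact pow_le_pow_left₀ (by positivity) h2 2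
  have hBd : (1 : ℝ) ≤ (B : ℝ) * d := by exact_mod_cast Nat.mul_pos hB1 hd1
  have hY2 : (B : ℝ) * d ≤ Y := by nlinarith
  have hm2 : ((n : ℝ) + 1) ^ 2 ≤ 2 * ((n + 1).factorial : ℝ) := by exact_mod_cast sq_le_two_fact n
  have hqn : (0 : ℝ) ≤ (q : ℝ) ^ n := by positivity
  have hsq : (0 : ℝ) ≤ √q * (q : ℝ) ^ n := by positivity
  set Z := ((2 * d : ℕ) : ℝ) ^ ((13 * (B : ℝ)) / 3) with hZ
  have hZ1 : 1 ≤ Z := by linarith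
  have key : |((n + 1).factorial : ℝ) * ((c : ℝ) - (q : ℝ) ^ (n + 1) /
      (((n + 1).factorial : ℝ) * 2 ^ B))| ≤
      ((n + 1).factorial : ℝ) * (25 * (Y * (√q * (q : ℝ) ^ n) + Z * (q : ℝ) ^ n)) := by
    have e : ((n + 1).factorial : ℝ) * ((c : ℝ) - (q : ℝ) ^ (n + 1) /
        (((n + 1).factorial : ℝ) * 2 ^ B)) =
        ((c * (n + 1).factorial : ℕ) : ℝ) - (q : ℝ) ^ (n + 1) / 2 ^ B := by
      push_cast; field_simp
    rw [e]
    refine hmain.trans ?_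
    have a1 : 25 * ((B : ℝ) * d) * √q * (q : ℝ) ^ n ≤
        ((n + 1).factorial : ℝ) * (25 * (Y * (√q * (q : ℝ) ^ n))) := by
      have b1 : ((B : ℝ) * d) * (√q * (q : ℝ) ^ n) ≤ Y * (√q * (q : ℝ) ^ n) :=
        mul_le_mul_of_nonneg_right hY2 hsq
      have b2 : Y * (√q * (q : ℝ) ^ n) ≤ ((n + 1).factorial : ℝ) * (Y * (√q * (q : ℝ) ^ n)) :=
        le_mul_of_one_le_left (mul_nonneg (by linarith) hsq) hfact1
      linarith
    have a2 : 3 * ((B : ℝ) * d) ^ 2 + (((n : ℝ) + 1) ^ 2 + B * d) ≤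
        ((n + 1).factorial : ℝ) * (25 * Z) := by
      have b1 : Z ≤ ((n + 1).factorial : ℝ) * Z := le_mul_of_one_le_left (by linarith) hfact1
      have b2 : ((n + 1).factorial : ℝ) ≤ ((n + 1).factorial : ℝ) * Z :=
        le_mul_of_one_le_right hfact.le hZ1
      linarith
    have a3 := mul_le_mul_of_nonneg_right a2 hqn
    linarith
  rw [abs_mul, abs_of_pos hfact] at key
  exact le_of_mul_le_mul_left key hfact
end
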